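/- arXiv:2412.11999 — 3 statements merged into one kernel-verified Lean document; each statement's English description precedes it below -/
import Mathlib

section
/- For n ≥ 1, the number of shallow 321-avoiding permutations of length n equals F_{2n-1}, the (2n-1)-st Fibonacci number (with F_1 = F_2 = 1). -/
open Equiv Finset

/-- Total displacement D(π) = Σ |π(i) - i|. -/
def dispD {n : ℕ} (π : Equiv.Perm (Fin n)) : ℕ :=
  ∑ i : Fin n, ((π i : ℤ) - (i : ℤ)).natAbs

/-- Inversion number I(π). -/
def invNum {n : ℕ} (π : Equiv.Perm (Fin n)) : ℕ :=
  (Finset.univ.filter (fun p : Fin n × Fin n => p.1 < p.2 ∧ π p.2 < π p.1)).card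

/-- Number of cycles of π, counting fixed points as cycles. -/
def cycNum {n : ℕ} (π : Equiv.Perm (Fin n)) : ℕ :=
  π.cycleType.card + (Finset.univ.filter (fun i => π i = i)).card

/-- Reflection length T(π) = n - cyc(π). -/
def reflLen {n : ℕ} (π : Equiv.Perm (Fin n)) : ℕ :=
  n - cycNum π

/-- A permutation is shallow when I(π) + T(π) = D(π). -/
def IsShallow {n : ℕ} (π : Equiv.Perm (Fin n)) : Prop :=
  invNum π + reflLen π = dispD π

def Avoids321 {n : ℕ} (π : Equiv.Perm (Fin n)) : Prop :=
  ¬ ∃ i j k : Fin n, i < j ∧ j < k ∧ π k < π j ∧ π j < π i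

def Avoids132 {n : ℕ} (π : Equiv.Perm (Fin n)) : Prop :=
  ¬ ∃ i j k : Fin n, i < j ∧ j < k ∧ π i < π k ∧ π k < π j

def Avoids231 {n : ℕ} (π : Equiv.Perm (Fin n)) : Prop :=
  ¬ ∃ i j k : Fin n, i < j ∧ j < k ∧ π k < π i ∧ π i < π j

namespace ShallowPerm

theorem reflLen_add_card_cycleType {n : ℕ} (π : Perm (Fin n)) :
    reflLen π + π.cycleType.card = π.cycleType.sum := by
  have h1 : π.cycleType.sum + (univ.filter fun i => π i = i).card = n := by
    rw [Perm.sum_cycleType]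
    have := Finset.card_filter_add_card_filter_not (s := univ) (fun i => π i = i)
    rw [Finset.card_univ, Fintype.card_fin] at this
    have h : π.support = univ.filter fun i => ¬ π i = i := by ext; simp
    rw [h]; omega
  have h2 : π.cycleType.card ≤ π.cycleType.sum := by
    have := Multiset.card_nsmul_le_sum (s := π.cycleType) (a := 1)
      fun x hx => (Perm.two_le_of_mem_cycleType hx).trans' (by norm_num)
    simpa using this
  unfold reflLen cycNum
  omega

theorem cycleType_swap_mul_of_isCycle {α : Type*} [Fintype α] [DecidableEq α] {g : Perm α}
    (hg : g.IsCycle) {x : α} (hx : g x ≠ x) :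
    (swap x (g x) * g).cycleType.sum + 1 + g.cycleType.card
      = g.cycleType.sum + (swap x (g x) * g).cycleType.card := by
  by_cases h : g (g x) = x
  · have h1 := hg.eq_swap_of_apply_apply_eq_self hx h
    have h2 : swap x (g x) * g = 1 := by
      nth_rw 2 [h1]
      simp
    rw [h2, hg.cycleType, h1, Perm.card_support_swap hx.symm]
    simp
  · have h1 := hg.swap_mul hx h
    have hm : x ∈ g.support := by simpa using hx
    have := Finset.card_pos.2 ⟨x, hm⟩
    rw [h1.cycleType, hg.cycleType, Perm.support_swap_mul_eq _ _ h,
      Finset.card_sdiff_of_subset (by simpa using hx)]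
    simp
    omega

theorem cycleType_swap_mul {α : Type*} [Fintype α] [DecidableEq α] (g : Perm α)
    {x : α} (hx : g x ≠ x) :
    (swap x (g x) * g).cycleType.sum + 1 + g.cycleType.card
      = g.cycleType.sum + (swap x (g x) * g).cycleType.card := by
  set c := g.cycleOf x with hc
  have hcx : c x = g x := Perm.cycleOf_apply_self g x
  have hmem : c ∈ g.cycleFactorsFinset := by
    rw [hc, Perm.cycleOf_mem_cycleFactorsFinset_iff]; simpa using hx
  have hd : Perm.Disjoint (g * c⁻¹) c := Perm.disjoint_mul_inv_of_mem_cycleFactorsFinset hmem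
  have hcyc : c.IsCycle := (Perm.mem_cycleFactorsFinset_iff.1 hmem).1
  have hg : g = c * (g * c⁻¹) := by
    rw [← hd.commute.eq]; simp
  set d := g * c⁻¹
  have hd' : Perm.Disjoint (swap x (c x) * c) d := by
    intro y
    rcases hd y with h | h
    · exact Or.inr h
    · left
      have h1 : y ≠ x := by rintro rfl; exact hx (hcx ▸ h)
      have h2 : y ≠ c x := by
        intro h2
        rw [h2] at h
        exact hx (hcx ▸ c.injective h)
      simp [h, swap_apply_of_ne_of_ne h1 h2]
  have key := cycleType_swap_mul_of_isCycle hcyc (x := x) (by rwa [hcx])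
  have e : swap x (g x) * g = (swap x (c x) * c) * d := by
    rw [hcx, mul_assoc, ← hg]
  have hgt : g.cycleType = c.cycleType + d.cycleType := by
    rw [← hd.symm.cycleType_mul, ← hg]
  rw [e, hd'.cycleType_mul, hgt]
  simp only [Multiset.sum_add, Multiset.card_add]
  omega

theorem decomposeFin_symm_zero_eq {n : ℕ} (e : Perm (Fin n)) :
    Perm.decomposeFin.symm (0, e) = e.extendDomain (finSuccAboveEquiv (0 : Fin (n + 1))) := by
  ext x
  refine Fin.cases ?_ (fun y => ?_) x
  · rw [Perm.extendDomain_apply_not_subtype _ _ (by simp)]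
    simp
  · have := Perm.extendDomain_apply_image e (finSuccAboveEquiv (0 : Fin (n + 1))) y
    simp [finSuccAboveEquiv_apply] at this
    simp [this]

theorem reflLen_decomposeFin_symm_zero {n : ℕ} (e : Perm (Fin n)) :
    reflLen (Perm.decomposeFin.symm (0, e)) = reflLen e := by
  have h1 := reflLen_add_card_cycleType (Perm.decomposeFin.symm (0, e))
  have h2 := reflLen_add_card_cycleType e
  rw [decomposeFin_symm_zero_eq, Perm.cycleType_extendDomain] at h1
  rw [decomposeFin_symm_zero_eq]
  omega

theorem reflLen_decomposeFin_symm_succ {n : ℕ} (q : Fin n) (e : Perm (Fin n)) :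
    reflLen (Perm.decomposeFin.symm (q.succ, e)) = reflLen e + 1 := by
  set g := Perm.decomposeFin.symm (q.succ, e) with hg
  have h0 : g 0 = q.succ := by simp [hg]
  have h1 := cycleType_swap_mul g (x := 0) (by rw [h0]; exact Fin.succ_ne_zero q)
  have h2 : swap 0 (g 0) * g = Perm.decomposeFin.symm (0, e) := by
    ext x
    refine Fin.cases ?_ (fun y => ?_) x
    · simp [h0]
    · simp [hg]
  rw [h2] at h1
  have h3 := reflLen_add_card_cycleType g
  have h4 := reflLen_add_card_cycleType (Perm.decomposeFin.symm (0, e))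
  have h5 := reflLen_decomposeFin_symm_zero e
  omega

theorem decomposeFin_symm_succ_apply_succ {n : ℕ} (e : Perm (Fin n)) (j x : Fin n) :
    Perm.decomposeFin.symm ((e j).succ, e) x.succ = if x = j then 0 else (e x).succ := by
  rw [Perm.decomposeFin_symm_apply_succ]
  split_ifs with h
  · simp [h]
  · exact swap_apply_of_ne_of_ne (Fin.succ_ne_zero _) (by simpa using h)

theorem dispD_decomposeFin_symm_zero {n : ℕ} (e : Perm (Fin n)) :
    dispD (Perm.decomposeFin.symm (0, e)) = dispD e := by
  simp [dispD, Fin.sum_univ_succ]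

theorem dispD_decomposeFin_symm_succ {n : ℕ} (e : Perm (Fin n)) (j : Fin n) :
    dispD (Perm.decomposeFin.symm ((e j).succ, e))
      = dispD e + 2 + 2 * min (e j : ℕ) (j : ℕ) := by
  have h : ∀ x : Fin n,
      ((Perm.decomposeFin.symm ((e j).succ, e) x.succ : ℤ) - (x.succ : ℤ)).natAbs
        + (if x = j then ((e j : ℤ) - (j : ℤ)).natAbs else 0)
      = ((e x : ℤ) - (x : ℤ)).natAbs + (if x = j then (j : ℕ) + 1 else 0) := by
    intro x
    rw [decomposeFin_symm_succ_apply_succ]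
    split_ifs with hx
    · subst hx
      simp only [Fin.val_zero, Fin.val_succ]
      omega
    · simp
  have hs := Finset.sum_congr (s₁ := univ) rfl fun x _ => h x
  simp only [Finset.sum_add_distrib, Finset.sum_ite_eq', mem_univ, if_true] at hs
  simp only [dispD, Fin.sum_univ_succ, Perm.decomposeFin_symm_apply_zero, Fin.val_zero,
    Fin.val_succ] at hs ⊢
  omega

theorem invNum_eq_sum {n : ℕ} (π : Perm (Fin n)) :
    invNum π = ∑ x, ∑ y, if x < y ∧ π y < π x then 1 else 0 := by
  rw [invNum, Finset.card_filter, ← Finset.univ_product_univ, Finset.sum_product]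

theorem invNum_decomposeFin_symm_zero {n : ℕ} (e : Perm (Fin n)) :
    invNum (Perm.decomposeFin.symm (0, e)) = invNum e := by
  simp only [invNum_eq_sum, Fin.sum_univ_succ, Perm.decomposeFin_symm_apply_zero,
    Perm.decomposeFin_symm_apply_succ, swap_self, Equiv.refl_apply, Fin.succ_lt_succ_iff,
    Fin.not_lt_zero, false_and, and_false, if_false, Finset.sum_const_zero, zero_add]

theorem sum_apply_lt {n : ℕ} (e : Perm (Fin n)) (q : Fin n) :
    ∑ y, (if e y < q then 1 else 0) = (q : ℕ) := by
  rw [Equiv.sum_comp e fun z => if z < q then 1 else 0, ← Finset.card_filter,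
    Finset.filter_gt_eq_Iio, Fin.card_Iio]

theorem invNum_decomposeFin_symm_succ {n : ℕ} (e : Perm (Fin n)) (j : Fin n) :
    invNum (Perm.decomposeFin.symm ((e j).succ, e))
      = invNum e + 1 + 2 * (univ.filter fun x => x < j ∧ e x < e j).card := by
  have hrow : ∀ y : Fin n,
      (if Perm.decomposeFin.symm ((e j).succ, e) y.succ < (e j).succ then 1 else 0)
        = (if e y < e j then 1 else 0) + (if y = j then 1 else 0) := by
    intro y
    rw [decomposeFin_symm_succ_apply_succ]
    by_cases hy : y = j <;> simp [hy]
  have hterm : ∀ x y : Fin n,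
      (if x < y ∧ Perm.decomposeFin.symm ((e j).succ, e) y.succ
          < Perm.decomposeFin.symm ((e j).succ, e) x.succ then 1 else 0)
        + (if x = j then (if j < y ∧ e y < e j then 1 else 0) else 0)
      = (if x < y ∧ e y < e x then 1 else 0)
        + (if y = j then (if x < j ∧ e x < e j then 1 else 0) else 0) := by
    intro x y
    simp only [decomposeFin_symm_succ_apply_succ]
    by_cases hx : x = j <;> by_cases hy : y = j
    · simp [hx, hy]
    · simp [hx, hy]
    · subst hy
      have : e x ≠ e y := by simpa using hx
      rcases lt_or_gt_of_ne this with h | h <;> simp [hx, h, h.not_gt]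
    · simp [hx, hy]
  have hs := Finset.sum_congr (s₁ := univ) rfl fun x _ =>
    Finset.sum_congr (s₁ := univ) rfl fun y _ => hterm x y
  simp only [Finset.sum_add_distrib, Finset.sum_ite_eq', mem_univ, if_true] at hs
  rw [Finset.sum_comm (f := fun x y => if x = j then _ else 0)] at hs
  simp only [Finset.sum_ite_eq', mem_univ, if_true] at hs
  have hsplit : ∑ y, (if j < y ∧ e y < e j then 1 else 0)
      + ∑ y, (if y < j ∧ e y < e j then 1 else 0) = (e j : ℕ) := by
    rw [← sum_apply_lt e (e j), ← Finset.sum_add_distrib]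
    refine Finset.sum_congr rfl fun y _ => ?_
    rcases lt_trichotomy y j with h | h | h <;> simp [h, h.not_gt]
  rw [invNum_eq_sum, invNum_eq_sum, Finset.card_filter]
  simp only [Fin.sum_univ_succ, Perm.decomposeFin_symm_apply_zero, Fin.succ_lt_succ_iff,
    Fin.succ_pos, Fin.not_lt_zero, false_and, if_false, true_and, hrow,
    zero_add, Finset.sum_add_distrib, sum_apply_lt, Finset.sum_ite_eq', mem_univ, if_true]
  omega

theorem card_filter_lt_lt_le {n : ℕ} (e : Perm (Fin n)) (j : Fin n) :
    (univ.filter fun x => x < j ∧ e x < e j).card ≤ min (e j : ℕ) (j : ℕ) := by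
  refine le_min ?_ ?_
  · rw [← sum_apply_lt e (e j), ← Finset.card_filter]
    exact Finset.card_le_card fun x => by simp
  · rw [← Fin.card_Iio j]
    exact Finset.card_le_card fun x => by simp +contextual

theorem invNum_add_reflLen_le_dispD {n : ℕ} (π : Perm (Fin n)) :
    invNum π + reflLen π ≤ dispD π := by
  induction n with
  | zero => simp [invNum, reflLen]
  | succ n ih =>
    obtain ⟨⟨p, e⟩, rfl⟩ := Perm.decomposeFin.symm.surjective π
    have he := ih e
    induction p using Fin.cases with
    | zero =>
      rwa [invNum_decomposeFin_symm_zero, reflLen_decomposeFin_symm_zero,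
        dispD_decomposeFin_symm_zero]
    | succ q =>
      obtain ⟨j, rfl⟩ := e.surjective q
      rw [invNum_decomposeFin_symm_succ, reflLen_decomposeFin_symm_succ,
        dispD_decomposeFin_symm_succ]
      have := card_filter_lt_lt_le e j
      omega

theorem avoids321_decomposeFin_symm_zero {n : ℕ} (e : Perm (Fin n)) :
    Avoids321 (Perm.decomposeFin.symm (0, e)) ↔ Avoids321 e := by
  simp [Avoids321, Fin.exists_fin_succ]

theorem avoids321_decomposeFin_symm_succ {n : ℕ} (e : Perm (Fin n)) (j : Fin n)
    (hj : (j : ℕ) = 0 ∨ (e j : ℕ) = 0) :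
    Avoids321 (Perm.decomposeFin.symm ((e j).succ, e)) ↔ Avoids321 e := by
  have hj' : (∀ x, ¬ x < j) ∨ ∀ x, ¬ e x < e j := by
    rcases hj with h | h
    · exact Or.inl fun x hx => by rw [Fin.lt_def] at hx; omega
    · exact Or.inr fun x hx => by rw [Fin.lt_def] at hx; omega
  refine not_congr ⟨?_, ?_⟩
  · rintro ⟨a, b, c, hab, hbc, hcb, hba⟩
    induction c using Fin.cases with
    | zero => exact absurd hbc (Fin.not_lt_zero _)
    | succ c =>
    induction b using Fin.cases with
    | zero => exact absurd hab (Fin.not_lt_zero _)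
    | succ b =>
    rw [decomposeFin_symm_succ_apply_succ] at hcb hba
    rw [decomposeFin_symm_succ_apply_succ] at hcb
    have hbj : b ≠ j := by
      rintro rfl
      simp at hcb
    rw [if_neg hbj] at hcb hba
    rw [Fin.succ_lt_succ_iff] at hbc
    induction a using Fin.cases with
    | zero =>
      rw [Perm.decomposeFin_symm_apply_zero, Fin.succ_lt_succ_iff] at hba
      rcases hj' with h | h
      · refine ⟨j, b, c, lt_of_le_of_ne (not_lt.1 (h b)) hbj.symm, hbc, ?_, hba⟩
        have hcj : c ≠ j := by
          rintro rfl
          exact h _ hbc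
        simpa [hcj] using hcb
      · exact absurd hba (h b)
    | succ a =>
      rw [Fin.succ_lt_succ_iff] at hab
      rw [decomposeFin_symm_succ_apply_succ] at hba
      have haj : a ≠ j := by
        rintro rfl
        simp at hba
      rw [if_neg haj, Fin.succ_lt_succ_iff] at hba
      refine ⟨a, b, c, hab, hbc, ?_, hba⟩
      by_cases hcj : c = j
      · subst hcj
        rcases hj' with h | h
        · exact absurd hbc (h b)
        · exact lt_of_le_of_ne (not_lt.1 (h b)) (by simpa using hbj.symm)
      · simpa [hcj] using hcb
  · rintro ⟨a, b, c, hab, hbc, hcb, hba⟩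
    have hbj : b ≠ j := by
      rintro rfl
      rcases hj' with h | h
      · exact h _ hab
      · exact h _ hcb
    by_cases haj : a = j
    · subst haj
      have hcj : c ≠ a := (hab.trans hbc).ne'
      refine ⟨0, b.succ, c.succ, Fin.succ_pos _, by simpa using hbc, ?_, ?_⟩
      · simpa [decomposeFin_symm_succ_apply_succ,
          -Perm.decomposeFin_symm_apply_succ, hbj, hcj] using hcb
      · simpa [decomposeFin_symm_succ_apply_succ,
          -Perm.decomposeFin_symm_apply_succ, hbj] using hba
    · refine ⟨a.succ, b.succ, c.succ, by simpa using hab, by simpa using hbc, ?_, ?_⟩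
      · by_cases hcj : c = j
        · simp [decomposeFin_symm_succ_apply_succ, -Perm.decomposeFin_symm_apply_succ, hbj, hcj]
        · simpa [decomposeFin_symm_succ_apply_succ,
            -Perm.decomposeFin_symm_apply_succ, hbj, hcj] using hcb
      · simpa [decomposeFin_symm_succ_apply_succ,
          -Perm.decomposeFin_symm_apply_succ, hbj, haj] using hba

theorem filter_lt_lt_eq_empty {n : ℕ} (e : Perm (Fin n)) (j : Fin n)
    (h : Avoids321 (Perm.decomposeFin.symm ((e j).succ, e))) :
    (univ.filter fun x => x < j ∧ e x < e j) = ∅ := by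
  refine Finset.filter_eq_empty_iff.2 fun x _ hx => h
    ⟨0, x.succ, j.succ, Fin.succ_pos _, Fin.succ_lt_succ_iff.2 hx.1, ?_, ?_⟩
  · simp [decomposeFin_symm_succ_apply_succ, -Perm.decomposeFin_symm_apply_succ, hx.1.ne]
  · simpa [decomposeFin_symm_succ_apply_succ,
      -Perm.decomposeFin_symm_apply_succ, hx.1.ne] using hx.2

/-- Shallow permutations avoiding `321`. -/
def IsShallow321 {n : ℕ} (π : Perm (Fin n)) : Prop := IsShallow π ∧ Avoids321 π

theorem isShallow321_decomposeFin_symm_zero {n : ℕ} (e : Perm (Fin n)) :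
    IsShallow321 (Perm.decomposeFin.symm (0, e)) ↔ IsShallow321 e := by
  rw [IsShallow321, IsShallow321, avoids321_decomposeFin_symm_zero, IsShallow, IsShallow,
    invNum_decomposeFin_symm_zero, reflLen_decomposeFin_symm_zero, dispD_decomposeFin_symm_zero]

theorem isShallow321_decomposeFin_symm_succ {n : ℕ} (e : Perm (Fin n)) (j : Fin n) :
    IsShallow321 (Perm.decomposeFin.symm ((e j).succ, e)) ↔
      IsShallow321 e ∧ ((j : ℕ) = 0 ∨ (e j : ℕ) = 0) := by
  have hle := invNum_add_reflLen_le_dispD e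
  have hcard := card_filter_lt_lt_le e j
  have hshallow : IsShallow (Perm.decomposeFin.symm ((e j).succ, e)) ↔
      invNum e + 1 + 2 * (univ.filter fun x => x < j ∧ e x < e j).card + (reflLen e + 1)
        = dispD e + 2 + 2 * min (e j : ℕ) (j : ℕ) := by
    rw [IsShallow, invNum_decomposeFin_symm_succ, reflLen_decomposeFin_symm_succ,
      dispD_decomposeFin_symm_succ]
  constructor
  · rintro ⟨hs, ha⟩
    rw [hshallow, filter_lt_lt_eq_empty e j ha, card_empty] at hs
    have hj : (j : ℕ) = 0 ∨ (e j : ℕ) = 0 := by omega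
    refine ⟨⟨?_, (avoids321_decomposeFin_symm_succ e j hj).1 ha⟩, hj⟩
    unfold IsShallow
    omega
  · rintro ⟨⟨hs, ha⟩, hj⟩
    refine ⟨hshallow.2 ?_, (avoids321_decomposeFin_symm_succ e j hj).2 ha⟩
    unfold IsShallow at hs
    omega

open Classical in
/-- The finite set of shallow permutations of `Fin n` avoiding `321`. -/
noncomputable def shallow321 (n : ℕ) : Finset (Perm (Fin n)) := univ.filter IsShallow321

theorem mem_shallow321 {n : ℕ} {π : Perm (Fin n)} : π ∈ shallow321 n ↔ IsShallow321 π := by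
  simp [shallow321]

theorem card_filter_apply_zero_eq_zero (n : ℕ) :
    ((shallow321 (n + 1)).filter fun e => e 0 = 0).card = (shallow321 n).card := by
  symm
  refine Finset.card_bij (fun e _ => Perm.decomposeFin.symm (0, e)) ?_ ?_ ?_
  · intro e he
    simpa [mem_shallow321, isShallow321_decomposeFin_symm_zero] using he
  · intro e _ e' _ h
    simpa using h
  · intro π hπ
    obtain ⟨⟨p, e⟩, rfl⟩ := Perm.decomposeFin.symm.surjective π
    rw [mem_filter, mem_shallow321, Perm.decomposeFin_symm_apply_zero] at hπ
    obtain ⟨h, rfl⟩ := hπ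
    exact ⟨e, mem_shallow321.2 ((isShallow321_decomposeFin_symm_zero e).1 h), rfl⟩

theorem isShallow321_decomposeFin_symm {n : ℕ} (p : Fin (n + 2)) (e : Perm (Fin (n + 1))) :
    IsShallow321 (Perm.decomposeFin.symm (p, e)) ↔
      IsShallow321 e ∧ p ∈ ({0, 1, (e 0).succ} : Finset (Fin (n + 2))) := by
  induction p using Fin.cases with
  | zero => simp [isShallow321_decomposeFin_symm_zero]
  | succ q =>
    obtain ⟨j, rfl⟩ := e.surjective q
    rw [isShallow321_decomposeFin_symm_succ, ← Fin.succ_zero_eq_one]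
    simp [-Fin.succ_zero_eq_one, -Fin.succ_zero_eq_one', Fin.val_eq_zero_iff, or_comm]

theorem card_shallow321_add_two (n : ℕ) :
    (shallow321 (n + 2)).card + (shallow321 n).card = 3 * (shallow321 (n + 1)).card := by
  have h : (shallow321 (n + 2)).card
      = ∑ e ∈ shallow321 (n + 1), ({0, 1, (e 0).succ} : Finset (Fin (n + 2))).card := by
    rw [← Finset.card_sigma]
    symm
    refine Finset.card_bij (fun x _ => Perm.decomposeFin.symm (x.2, x.1)) ?_ ?_ ?_
    · rintro ⟨e, p⟩ hx
      rw [mem_sigma, mem_shallow321] at hx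
      exact mem_shallow321.2 ((isShallow321_decomposeFin_symm p e).2 hx)
    · rintro ⟨e, p⟩ _ ⟨e', p'⟩ _ h
      obtain ⟨rfl, rfl⟩ : p = p' ∧ e = e' := by simpa using h
      rfl
    · intro π hπ
      obtain ⟨⟨p, e⟩, rfl⟩ := Perm.decomposeFin.symm.surjective π
      have := (isShallow321_decomposeFin_symm p e).1 (mem_shallow321.1 hπ)
      exact ⟨⟨e, p⟩, mem_sigma.2 ⟨mem_shallow321.2 this.1, this.2⟩, rfl⟩
  have hcard : ∀ e : Perm (Fin (n + 1)),
      ({0, 1, (e 0).succ} : Finset (Fin (n + 2))).card + (if e 0 = 0 then 1 else 0) = 3 := by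
    intro e
    rw [← Fin.succ_zero_eq_one]
    split_ifs with h0
    · rw [h0, Finset.pair_eq_singleton, Finset.card_pair (Fin.succ_ne_zero 0).symm]
    · rw [Finset.card_eq_three.2 ⟨0, (0 : Fin (n + 1)).succ, (e 0).succ,
        (Fin.succ_ne_zero _).symm, (Fin.succ_ne_zero _).symm,
        fun h => h0 (Fin.succ_injective _ h).symm, rfl⟩]
  rw [h, ← card_filter_apply_zero_eq_zero, Finset.card_filter, ← Finset.sum_add_distrib,
    Finset.sum_congr rfl fun e _ => hcard e]
  simp [mul_comm]

theorem card_shallow321_zero : (shallow321 0).card = 1 := by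
  rw [Finset.card_eq_one]
  refine ⟨1, ?_⟩
  ext π
  rw [mem_shallow321, mem_singleton, Subsingleton.elim π 1]
  simp [IsShallow321, IsShallow, Avoids321, invNum, reflLen, dispD]

theorem card_shallow321_one : (shallow321 1).card = 1 := by
  have h := card_filter_apply_zero_eq_zero 0
  rwa [card_shallow321_zero,
    Finset.filter_true_of_mem fun (e : Perm (Fin 1)) _ => Subsingleton.elim (e 0) 0] at h

theorem card_shallow321_succ (n : ℕ) : (shallow321 (n + 1)).card = Nat.fib (2 * n + 1) := by
  induction n using Nat.twoStepInduction with
  | zero => simp [card_shallow321_one]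
  | one =>
    have := card_shallow321_add_two 0
    rw [card_shallow321_zero, zero_add, zero_add, card_shallow321_one] at this
    rw [show Nat.fib (2 * 1 + 1) = 2 from rfl, one_add_one_eq_two]
    omega
  | more n ih1 ih2 =>
    have h := card_shallow321_add_two (n + 1)
    rw [ih1, ih2, show n + 1 + 2 = n + 2 + 1 by ring, show 2 * (n + 1) + 1 = 2 * n + 3 by ring] at h
    rw [show 2 * (n + 2) + 1 = 2 * n + 5 by ring]
    have h1 : Nat.fib (2 * n + 3) = Nat.fib (2 * n + 1) + Nat.fib (2 * n + 2) := Nat.fib_add_two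
    have h2 : Nat.fib (2 * n + 4) = Nat.fib (2 * n + 2) + Nat.fib (2 * n + 3) := Nat.fib_add_two
    have h3 : Nat.fib (2 * n + 5) = Nat.fib (2 * n + 3) + Nat.fib (2 * n + 4) := Nat.fib_add_two
    omega

end ShallowPerm

theorem stmt14 (n : ℕ) (hn : 1 ≤ n) :
    Nat.card {π : Equiv.Perm (Fin n) // IsShallow π ∧ Avoids321 π} =
      Nat.fib (2 * n - 1) := by
  obtain ⟨m, rfl⟩ := Nat.exists_eq_add_of_le' hn
  rw [show 2 * (m + 1) - 1 = 2 * m + 1 by omega, ← ShallowPerm.card_shallow321_succ]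
  exact Nat.subtype_card _ fun π => ShallowPerm.mem_shallow321
end

section
/- For n ≥ 1, the number of shallow 132-avoiding permutations of length n equals F_{2n-1}, the (2n-1)-st Fibonacci number (with F_1 = F_2 = 1). -/
open Equiv Finset

theorem sum_eq_pair_add_sum_compl {α M : Type*} [Fintype α] [DecidableEq α] [AddCommMonoid M]
    {i j : α} (hij : i ≠ j) (f : α → M) :
    ∑ a, f a = f i + f j + ∑ a ∈ ({i, j} : Finset α)ᶜ, f a := by
  rw [← Finset.sum_add_sum_compl ({i, j} : Finset α), Finset.sum_pair hij]

theorem dispD_mul_swap {n : ℕ} (σ : Perm (Fin n)) {i j : Fin n} (hij : i ≠ j) :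
    (dispD (σ * swap i j) : ℤ) + |(σ i : ℤ) - i| + |(σ j : ℤ) - j| =
      dispD σ + |(σ j : ℤ) - i| + |(σ i : ℤ) - j| := by
  have hrest : ∑ a ∈ ({i, j} : Finset (Fin n))ᶜ, |(((σ * swap i j) a : Fin n) : ℤ) - a| =
      ∑ a ∈ ({i, j} : Finset (Fin n))ᶜ, |((σ a : Fin n) : ℤ) - a| := by
    refine Finset.sum_congr rfl fun a ha => ?_
    simp only [mem_compl, mem_insert, mem_singleton, not_or] at ha
    rw [Perm.mul_apply, swap_apply_of_ne_of_ne ha.1 ha.2]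
  simp only [dispD, Nat.cast_sum, Int.natCast_natAbs]
  rw [sum_eq_pair_add_sum_compl hij, hrest, sum_eq_pair_add_sum_compl hij (fun a => |(σ a : ℤ) - a|)]
  simp only [Perm.mul_apply, swap_apply_left, swap_apply_right]
  ring

theorem invNum_eq_sum {n : ℕ} (π : Perm (Fin n)) :
    invNum π = ∑ a, ∑ b, if a < b ∧ π b < π a then 1 else 0 := by
  rw [invNum, Finset.card_filter, ← Finset.univ_product_univ, Finset.sum_product]

/-- Composing with a transposition that creates an inversion adds that inversion and two more for
every entry lying in the rectangle spanned by the two exchanged entries. -/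
theorem invNum_mul_swap {n : ℕ} (σ : Perm (Fin n)) {i j : Fin n} (hij : i < j) (hσ : σ i < σ j) :
    invNum (σ * swap i j) =
      invNum σ + 1 + 2 * #{k | i < k ∧ k < j ∧ σ i < σ k ∧ σ k < σ j} := by
  have hbox : #{k | i < k ∧ k < j ∧ σ i < σ k ∧ σ k < σ j} =
      ∑ k ∈ ({i, j} : Finset (Fin n))ᶜ, if i < k ∧ k < j ∧ σ i < σ k ∧ σ k < σ j then 1 else 0 := by
    rw [Finset.card_filter, sum_eq_pair_add_sum_compl hij.ne]
    simp
  have hval : ∀ k ∈ ({i, j} : Finset (Fin n))ᶜ, (σ * swap i j) k = σ k := fun k hk => by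
    simp only [mem_compl, mem_insert, mem_singleton, not_or] at hk
    rw [Perm.mul_apply, swap_apply_of_ne_of_ne hk.1 hk.2]
  have hi : (σ * swap i j) i = σ j := by simp
  have hj : (σ * swap i j) j = σ i := by simp
  have split : ∀ g : Fin n → Fin n → ℕ, ∑ a, ∑ b, g a b =
      g i i + g i j + g j i + g j j +
        ∑ k ∈ ({i, j} : Finset (Fin n))ᶜ, (g i k + g j k + g k i + g k j) +
        ∑ a ∈ ({i, j} : Finset (Fin n))ᶜ, ∑ b ∈ ({i, j} : Finset (Fin n))ᶜ, g a b := fun g => by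
    simp only [sum_eq_pair_add_sum_compl hij.ne, Finset.sum_add_distrib]
    ring
  rw [invNum_eq_sum, invNum_eq_sum, split, split, hbox, Finset.mul_sum]
  have hin : ∑ a ∈ ({i, j} : Finset (Fin n))ᶜ, ∑ b ∈ ({i, j} : Finset (Fin n))ᶜ,
        (if a < b ∧ (σ * swap i j) b < (σ * swap i j) a then 1 else 0) =
      ∑ a ∈ ({i, j} : Finset (Fin n))ᶜ, ∑ b ∈ ({i, j} : Finset (Fin n))ᶜ,
        (if a < b ∧ σ b < σ a then 1 else 0) :=
    Finset.sum_congr rfl fun a ha => Finset.sum_congr rfl fun b hb => by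
      rw [hval a ha, hval b hb]
  have hcross : ∀ k ∈ ({i, j} : Finset (Fin n))ᶜ,
      ((if i < k ∧ (σ * swap i j) k < (σ * swap i j) i then 1 else 0) +
        (if j < k ∧ (σ * swap i j) k < (σ * swap i j) j then 1 else 0) +
        (if k < i ∧ (σ * swap i j) i < (σ * swap i j) k then 1 else 0) +
        (if k < j ∧ (σ * swap i j) j < (σ * swap i j) k then 1 else 0) : ℕ) =
      ((if i < k ∧ σ k < σ i then 1 else 0) + (if j < k ∧ σ k < σ j then 1 else 0) +
        (if k < i ∧ σ i < σ k then 1 else 0) + (if k < j ∧ σ j < σ k then 1 else 0)) +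
      2 * (if i < k ∧ k < j ∧ σ i < σ k ∧ σ k < σ j then 1 else 0) := fun k hk => by
    rw [hval k hk, hi, hj]
    simp only [mem_compl, mem_insert, mem_singleton, not_or] at hk
    have hki : σ k ≠ σ i := fun h => hk.1 (σ.injective h)
    have hkj : σ k ≠ σ j := fun h => hk.2 (σ.injective h)
    obtain ⟨h1, h2⟩ := hk
    simp only [Fin.lt_def, ne_eq, Fin.ext_iff] at *
    split_ifs <;> omega
  rw [hin, Finset.sum_congr rfl hcross, Finset.sum_add_distrib, hi, hj]
  have h1 : ¬ σ j < σ i := hσ.asymm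
  have h2 : ¬ j < i := hij.asymm
  simp only [hij, hσ, h1, h2, lt_irrefl, and_self, and_false, if_true, if_false, and_true]
  ring

theorem reflLen_eq {n : ℕ} (π : Perm (Fin n)) :
    reflLen π + π.cycleType.card = π.cycleType.sum := by
  have hfix : #{i | π i = i} + π.cycleType.sum = n := by
    rw [Perm.sum_cycleType, Perm.support]
    simpa using Finset.card_filter_add_card_filter_not (s := univ) (fun i => π i = i)
  have hle : π.cycleType.card ≤ π.cycleType.sum := by
    simpa using Multiset.card_nsmul_le_sum (s := π.cycleType) (a := 1)
      fun x hx => (Perm.one_lt_of_mem_cycleType hx).le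
  rw [reflLen, cycNum]
  omega

theorem reflLen_inv {n : ℕ} (π : Perm (Fin n)) : reflLen π⁻¹ = reflLen π := by
  have h := reflLen_eq π⁻¹
  rw [Perm.cycleType_inv, ← reflLen_eq π] at h
  omega

/-- Merging a fixed point into another cycle raises the reflection length by one. -/
theorem reflLen_swap_mul {n : ℕ} (σ : Perm (Fin n)) {x y : Fin n} (hxy : x ≠ y) (hx : σ x = x) :
    reflLen (swap x y * σ) = reflLen σ + 1 := by
  have h := reflLen_eq σ
  have h' := reflLen_eq (swap x y * σ)
  by_cases hy : σ y = y
  · have hd : Perm.Disjoint (swap x y) σ := fun z => by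
      by_cases hzx : z = x
      · exact Or.inr (hzx ▸ hx)
      by_cases hzy : z = y
      · exact Or.inr (hzy ▸ hy)
      exact Or.inl (swap_apply_of_ne_of_ne hzx hzy)
    rw [hd.cycleType_mul, (Perm.isCycle_swap hxy).cycleType, Perm.card_support_swap hxy] at h'
    simp at h'
    omega
  · have hcyc : (σ.cycleOf y).IsCycle := Perm.isCycle_cycleOf σ hy
    have hdisj : Perm.Disjoint (σ * (σ.cycleOf y)⁻¹) (σ.cycleOf y) :=
      Perm.disjoint_mul_inv_of_mem_cycleFactorsFinset
        (Perm.cycleOf_mem_cycleFactorsFinset_iff.2 (Perm.mem_support.2 hy))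
    have hfactor : σ = σ.cycleOf y * (σ * (σ.cycleOf y)⁻¹) := by
      rw [← hdisj.commute.eq, inv_mul_cancel_right]
    have hcx : σ.cycleOf y x = x := by
      by_contra hne
      have := Perm.support_cycleOf_le σ y (Perm.mem_support.2 hne)
      exact Perm.mem_support.1 this hx
    have hcy : σ.cycleOf y y ≠ y := by rwa [Perm.cycleOf_apply_self]
    have hxl : x ∉ Perm.toList σ y := fun hmem =>
      hy ((Perm.mem_toList_iff.1 hmem).1.apply_eq_self_iff.2 hx)
    have hlist : ∃ l, Perm.toList σ y = y :: l := by
      have hpos := Perm.length_toList_pos_of_mem_support σ y (Perm.mem_support.2 hy)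
      have hhead := Perm.toList_getElem_zero σ y (Perm.mem_support.2 hy)
      cases hl : Perm.toList σ y with
      | nil => simp [hl] at hpos
      | cons a l => exact ⟨l, by simp only [hl, List.getElem_cons_zero] at hhead; rw [hhead]⟩
    obtain ⟨l, hl⟩ := hlist
    have hform : swap x y * σ.cycleOf y = List.formPerm (x :: y :: l) := by
      rw [List.formPerm_cons_cons, ← hl, Perm.formPerm_toList]
    have hnodup : (x :: y :: l).Nodup := by
      rw [← hl]
      exact List.nodup_cons.2 ⟨hxl, Perm.nodup_toList σ y⟩
    have hcyc' : (swap x y * σ.cycleOf y).IsCycle := by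
      rw [hform]
      exact List.isCycle_formPerm hnodup (by simp)
    have hcard : #(swap x y * σ.cycleOf y).support = #(σ.cycleOf y).support + 1 := by
      rw [hform, List.support_formPerm_of_nodup _ hnodup (by simp), List.toFinset_card_of_nodup hnodup,
        ← Perm.length_toList, hl]
      simp
    have hdisj' : Perm.Disjoint (swap x y * σ.cycleOf y) (σ * (σ.cycleOf y)⁻¹) := fun z => by
      rcases hdisj z with hz | hz
      · exact Or.inr hz
      by_cases hzx : z = x
      · right
        rw [hzx, Perm.mul_apply, Perm.inv_eq_iff_eq.2 hcx.symm, hx]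
      left
      have hzy : z ≠ y := fun h => hcy (h ▸ hz)
      rw [Perm.mul_apply, hz, swap_apply_of_ne_of_ne hzx hzy]
    have hprod : swap x y * σ = swap x y * σ.cycleOf y * (σ * (σ.cycleOf y)⁻¹) := by
      rw [mul_assoc, ← hfactor]
    rw [hprod, hdisj'.cycleType_mul, hcyc'.cycleType, hcard, ← hprod] at h'
    rw [hfactor, hdisj.symm.cycleType_mul, hcyc.cycleType, ← hfactor] at h
    simp only [Multiset.card_add, Multiset.card_singleton, Multiset.sum_add,
      Multiset.sum_singleton] at h h'
    omega

/-- The permutation obtained from `e` by inserting the value `p` at position `i`. -/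
def insertEntry {n : ℕ} (i p : Fin (n + 1)) (e : Perm (Fin n)) : Perm (Fin (n + 1)) :=
  (finSuccEquiv' i).trans ((optionCongr e).trans (finSuccEquiv' p).symm)

@[simp]
theorem insertEntry_self {n : ℕ} (i p : Fin (n + 1)) (e : Perm (Fin n)) :
    insertEntry i p e i = p := by
  simp [insertEntry]

@[simp]
theorem insertEntry_succAbove {n : ℕ} (i p : Fin (n + 1)) (e : Perm (Fin n)) (k : Fin n) :
    insertEntry i p e (i.succAbove k) = p.succAbove (e k) := by
  simp [insertEntry]

theorem insertEntry_injective {n : ℕ} (i p : Fin (n + 1)) :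
    Function.Injective (insertEntry i p) := fun e f h => by
  ext k : 1
  refine Fin.succAbove_right_injective (p := p) ?_
  simp only [← insertEntry_succAbove i p, h]

theorem exists_insertEntry {n : ℕ} {i p : Fin (n + 1)} {π : Perm (Fin (n + 1))} (h : π i = p) :
    ∃ e, insertEntry i p e = π := by
  refine ⟨removeNone ((finSuccEquiv' i).symm.trans (π.trans (finSuccEquiv' p))), ?_⟩
  have hnone : ((finSuccEquiv' i).symm.trans (π.trans (finSuccEquiv' p))) none = none := by
    simp [h]
  rw [insertEntry, map_equiv_removeNone, hnone, swap_self]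
  ext k : 1
  simp

theorem insertEntry_eq_extendDomain {n : ℕ} (i : Fin (n + 1)) (e : Perm (Fin n)) :
    insertEntry i i e = e.extendDomain (finSuccAboveEquiv i) := by
  ext k : 1
  rcases Fin.eq_self_or_eq_succAbove i k with rfl | ⟨k, rfl⟩
  · rw [insertEntry_self, Perm.extendDomain_apply_not_subtype _ _ (by simp)]
  · rw [insertEntry_succAbove]
    exact (Perm.extendDomain_apply_image e (finSuccAboveEquiv i) k).symm

theorem reflLen_insertEntry_self {n : ℕ} (i : Fin (n + 1)) (e : Perm (Fin n)) :
    reflLen (insertEntry i i e) = reflLen e := by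
  have h := reflLen_eq (insertEntry i i e)
  rw [insertEntry_eq_extendDomain, Perm.cycleType_extendDomain, ← reflLen_eq e,
    ← insertEntry_eq_extendDomain] at h
  omega

/-- The defect in the inequality `I(π) + T(π) ≤ D(π)`. -/
def excess {n : ℕ} (π : Perm (Fin n)) : ℤ :=
  dispD π - invNum π - reflLen π

theorem isShallow_iff_excess {n : ℕ} {π : Perm (Fin n)} : IsShallow π ↔ excess π = 0 := by
  rw [IsShallow, excess]
  omega

theorem excess_inv {n : ℕ} (π : Perm (Fin n)) : excess π⁻¹ = excess π := by
  have hD : dispD π⁻¹ = dispD π := by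
    rw [dispD, dispD, ← Equiv.sum_comp π]
    refine Finset.sum_congr rfl fun i _ => ?_
    rw [Perm.inv_def, symm_apply_apply]
    omega
  have hI : invNum π⁻¹ = invNum π := by
    rw [invNum_eq_sum, invNum_eq_sum, ← Equiv.sum_comp π, Finset.sum_comm]
    rw [← Equiv.sum_comp π]
    refine Finset.sum_congr rfl fun i _ => Finset.sum_congr rfl fun j _ => ?_
    simp only [Perm.inv_def, symm_apply_apply, and_comm]
  rw [excess, excess, hD, hI, reflLen_inv]

theorem excess_insertEntry_last {n : ℕ} (e : Perm (Fin n)) :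
    excess (insertEntry (Fin.last n) (Fin.last n) e) = excess e := by
  have hval : ∀ k : Fin n, insertEntry (Fin.last n) (Fin.last n) e k.castSucc = (e k).castSucc :=
    fun k => by simpa using insertEntry_succAbove (Fin.last n) (Fin.last n) e k
  have hD : dispD (insertEntry (Fin.last n) (Fin.last n) e) = dispD e := by
    simp [dispD, Fin.sum_univ_castSucc, hval]
  have hI : invNum (insertEntry (Fin.last n) (Fin.last n) e) = invNum e := by
    simp only [invNum_eq_sum, Fin.sum_univ_castSucc, hval, insertEntry_self]
    simp [-sum_boole, Fin.le_last, not_lt_of_ge]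
  rw [excess, excess, hD, hI, reflLen_insertEntry_self]

theorem excess_insertEntry_zero {n : ℕ} (e : Perm (Fin n)) :
    excess (insertEntry 0 0 e) = excess e := by
  have hval : ∀ k : Fin n, insertEntry 0 0 e k.succ = (e k).succ :=
    fun k => by simpa using insertEntry_succAbove 0 0 e k
  have hD : dispD (insertEntry 0 0 e) = dispD e := by
    simp [dispD, Fin.sum_univ_succ, hval]
  have hI : invNum (insertEntry 0 0 e) = invNum e := by
    simp only [invNum_eq_sum, Fin.sum_univ_succ, hval, insertEntry_self]
    simp [-sum_boole]
  rw [excess, excess, hD, hI, reflLen_insertEntry_self]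

theorem card_filter_map_mem_le_right {α : Type*} [DecidableEq α] (σ : Perm α) (S T : Finset α) :
    #{k ∈ S | σ k ∈ T} ≤ #T :=
  Finset.card_le_card_of_injOn σ (fun _ hk => (Finset.mem_filter.1 hk).2) σ.injective.injOn

theorem card_filter_map_mem_eq_right_iff {α : Type*} [DecidableEq α] (σ : Perm α)
    (S T : Finset α) : #{k ∈ S | σ k ∈ T} = #T ↔ ∀ k, σ k ∈ T → k ∈ S := by
  have himage : {k ∈ S | σ k ∈ T}.image σ ⊆ T := by
    rintro _ hv
    obtain ⟨k, hk, rfl⟩ := Finset.mem_image.1 hv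
    exact (Finset.mem_filter.1 hk).2
  rw [← Finset.card_image_of_injective _ σ.injective]
  constructor
  · intro h k hk
    rw [← Finset.eq_of_subset_of_card_le himage h.ge, Finset.mem_image] at hk
    obtain ⟨l, hl, hlk⟩ := hk
    rw [← σ.injective hlk]
    exact (Finset.mem_filter.1 hl).1
  · intro h
    congr 1
    refine himage.antisymm fun v hv => Finset.mem_image.2 ⟨σ.symm v, ?_, by simp⟩
    simpa [hv] using h (σ.symm v)

theorem excess_mul_swap {n : ℕ} (σ : Perm (Fin n)) {i j : Fin n} (hij : i < j) (hσ : σ i < σ j)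
    (hfix : σ i = i ∨ σ j = j) :
    excess (σ * swap i j) = excess σ + |(σ j : ℤ) - i| + |(σ i : ℤ) - j| - |(σ i : ℤ) - i|
      - |(σ j : ℤ) - j| - 2 - 2 * #{k ∈ Ioo i j | σ k ∈ Ioo (σ i) (σ j)} := by
  have hT : reflLen (σ * swap i j) = reflLen σ + 1 := by
    rw [mul_swap_eq_swap_mul]
    rcases hfix with h | h
    · rw [h]
      exact reflLen_swap_mul σ (h ▸ hσ.ne) h
    · rw [h, swap_comm]
      exact reflLen_swap_mul σ (h ▸ hσ.ne') h
  have hD := dispD_mul_swap σ hij.ne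
  have hI := invNum_mul_swap σ hij hσ
  have hbox : #{k | i < k ∧ k < j ∧ σ i < σ k ∧ σ k < σ j} =
      #{k ∈ Ioo i j | σ k ∈ Ioo (σ i) (σ j)} := by
    congr 1
    ext k
    simp [and_assoc]
  rw [excess, excess, hT, hI, hbox]
  push_cast
  linarith

/-- `j` is the position of a left-to-right maximum or of a right-to-left minimum of `σ`. -/
def IsExtremal {n : ℕ} (σ : Perm (Fin n)) (j : Fin n) : Prop :=
  (∀ k, k < j → σ k < σ j) ∨ ∀ k, j < k → σ j < σ k

theorem excess_mul_swap_last {n : ℕ} (σ : Perm (Fin (n + 1))) (hσ : σ (Fin.last n) = Fin.last n)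
    {j : Fin (n + 1)} (hj : j ≠ Fin.last n) :
    excess σ ≤ excess (σ * swap j (Fin.last n)) ∧
      (excess (σ * swap j (Fin.last n)) = excess σ ↔ IsExtremal σ j) := by
  have hjlt : j < Fin.last n := Fin.lt_last_iff_ne_last.2 hj
  have hne : σ j ≠ Fin.last n := fun h => hj (σ.injective (h.trans hσ.symm))
  have hmlt : σ j < Fin.last n := Fin.lt_last_iff_ne_last.2 hne
  have key := excess_mul_swap σ hjlt (hσ.symm ▸ hmlt) (Or.inr hσ)
  rw [hσ] at key
  have hS := Finset.card_filter_le (Ioo j (Fin.last n)) (fun k => σ k ∈ Ioo (σ j) (Fin.last n))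
  have hT := card_filter_map_mem_le_right σ (Ioo j (Fin.last n)) (Ioo (σ j) (Fin.last n))
  have hS' := Finset.card_filter_eq_iff (s := Ioo j (Fin.last n))
    (p := fun k => σ k ∈ Ioo (σ j) (Fin.last n))
  have hT' := card_filter_map_mem_eq_right_iff σ (Ioo j (Fin.last n)) (Ioo (σ j) (Fin.last n))
  have hlast : ∀ k, σ k < Fin.last n ↔ k < Fin.last n := fun k => by
    rw [Fin.lt_last_iff_ne_last, Fin.lt_last_iff_ne_last, ← hσ, σ.injective.ne_iff, hσ]
  have hext : IsExtremal σ j ↔ (∀ k, σ k ∈ Ioo (σ j) (Fin.last n) → k ∈ Ioo j (Fin.last n)) ∨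
      (∀ k ∈ Ioo j (Fin.last n), σ k ∈ Ioo (σ j) (Fin.last n)) := by
    simp only [mem_Ioo, hlast]
    refine or_congr ⟨fun h k hk => ⟨?_, hk.2⟩, fun h k hk => ?_⟩
      ⟨fun h k hk => ⟨h k hk.1, hk.2⟩, fun h k hk => ?_⟩
    · by_contra hle
      rcases (not_lt.1 hle).lt_or_eq with hlt | rfl
      · exact (h k hlt).asymm hk.1
      · exact lt_irrefl _ hk.1
    · by_contra hle
      have hne : σ j ≠ σ k := fun h => hk.ne (σ.injective h).symm
      exact (h k ⟨lt_of_le_of_ne (not_lt.1 hle) hne, hk.trans hjlt⟩).1.asymm hk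
    · rcases (Fin.le_last k).lt_or_eq with hlt | rfl
      · exact (h k ⟨hk, hlt⟩).1
      · rwa [hσ]
  rw [hext, ← hT', ← hS', key]
  have h1 : (j : ℕ) < n := hjlt
  have h2 : (σ j : ℕ) < n := hmlt
  simp only [Fin.card_Ioo, Fin.val_last] at hS hT ⊢
  generalize #{k ∈ Ioo j (Fin.last n) | σ k ∈ Ioo (σ j) (Fin.last n)} = c at hS hT ⊢
  generalize (σ j : ℕ) = m at h2 hS hT ⊢
  generalize (j : ℕ) = j' at h1 hS hT ⊢
  rw [abs_of_nonneg (by omega : (0:ℤ) ≤ n - j'), abs_of_nonpos (by omega : (m:ℤ) - n ≤ 0)]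
  rcases abs_cases ((m : ℤ) - j') with h | h <;> simp <;> omega

theorem excess_mul_swap_zero {n : ℕ} (σ : Perm (Fin (n + 1))) (hσ : σ 0 = 0)
    {j : Fin (n + 1)} (hj : j ≠ 0) :
    excess σ ≤ excess (σ * swap 0 j) ∧
      (excess (σ * swap 0 j) = excess σ ↔ IsExtremal σ j) := by
  have hjpos : 0 < j := Fin.pos_iff_ne_zero.2 hj
  have hne : σ j ≠ 0 := fun h => hj (σ.injective (h.trans hσ.symm))
  have hmpos : 0 < σ j := Fin.pos_iff_ne_zero.2 hne
  have key := excess_mul_swap σ hjpos (hσ.symm ▸ hmpos) (Or.inl hσ)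
  rw [hσ] at key
  have hS := Finset.card_filter_le (Ioo 0 j) (fun k => σ k ∈ Ioo 0 (σ j))
  have hT := card_filter_map_mem_le_right σ (Ioo 0 j) (Ioo 0 (σ j))
  have hS' := Finset.card_filter_eq_iff (s := Ioo 0 j) (p := fun k => σ k ∈ Ioo 0 (σ j))
  have hT' := card_filter_map_mem_eq_right_iff σ (Ioo 0 j) (Ioo 0 (σ j))
  have hzero : ∀ k, 0 < σ k ↔ 0 < k := fun k => by
    rw [Fin.pos_iff_ne_zero, Fin.pos_iff_ne_zero, ← hσ, σ.injective.ne_iff, hσ]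
  have hext : IsExtremal σ j ↔ (∀ k ∈ Ioo 0 j, σ k ∈ Ioo 0 (σ j)) ∨
      (∀ k, σ k ∈ Ioo 0 (σ j) → k ∈ Ioo 0 j) := by
    simp only [mem_Ioo, hzero]
    refine or_congr ⟨fun h k hk => ⟨hk.1, h k hk.2⟩, fun h k hk => ?_⟩
      ⟨fun h k hk => ⟨hk.1, ?_⟩, fun h k hk => ?_⟩
    · rcases (Fin.zero_le k).lt_or_eq with hlt | rfl
      · exact (h k ⟨hlt, hk⟩).2
      · rwa [hσ]
    · by_contra hle
      rcases (not_lt.1 hle).lt_or_eq with hlt | rfl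
      · exact (h k hlt).asymm hk.2
      · exact lt_irrefl _ hk.2
    · by_contra hle
      have hne : σ k ≠ σ j := fun h => hk.ne (σ.injective h).symm
      exact (h k ⟨hjpos.trans hk, lt_of_le_of_ne (not_lt.1 hle) hne⟩).2.asymm hk
  rw [hext, ← hT', ← hS', key]
  have h1 : 0 < (j : ℕ) := hjpos
  have h2 : 0 < (σ j : ℕ) := hmpos
  simp only [Fin.card_Ioo, Fin.val_zero] at hS hT ⊢
  generalize #{k ∈ Ioo 0 j | σ k ∈ Ioo 0 (σ j)} = c at hS hT ⊢
  generalize (σ j : ℕ) = m at h2 hS hT ⊢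
  generalize (j : ℕ) = j' at h1 hS hT ⊢
  rcases abs_cases ((m : ℤ) - j') with h | h <;> simp <;> omega

theorem excess_nonneg {n : ℕ} (π : Perm (Fin n)) : 0 ≤ excess π := by
  induction n with
  | zero => simp [excess, dispD, invNum, reflLen]
  | succ n ih =>
    have hfixed : ∀ σ : Perm (Fin (n + 1)), σ (Fin.last n) = Fin.last n → 0 ≤ excess σ :=
      fun σ hσ => by
        obtain ⟨e, rfl⟩ := exists_insertEntry hσ
        rw [excess_insertEntry_last]
        exact ih e
    by_cases h : π (Fin.last n) = Fin.last n
    · exact hfixed π h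
    · have hj : π.symm (Fin.last n) ≠ Fin.last n := fun h' => h (by rw [← h', apply_symm_apply, h'])
      have hσ : (π * swap (π.symm (Fin.last n)) (Fin.last n)) (Fin.last n) = Fin.last n := by simp
      have hle := (excess_mul_swap_last _ hσ hj).1
      rw [mul_assoc, swap_mul_self, mul_one] at hle
      exact (hfixed _ hσ).trans hle

theorem isShallow_mul_swap_last {n : ℕ} (σ : Perm (Fin (n + 1))) (hσ : σ (Fin.last n) = Fin.last n)
    {j : Fin (n + 1)} (hj : j ≠ Fin.last n) :
    IsShallow (σ * swap j (Fin.last n)) ↔ IsShallow σ ∧ IsExtremal σ j := by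
  obtain ⟨hle, hiff⟩ := excess_mul_swap_last σ hσ hj
  have hpos := excess_nonneg σ
  rw [isShallow_iff_excess, isShallow_iff_excess, ← hiff]
  omega

theorem isShallow_mul_swap_zero {n : ℕ} (σ : Perm (Fin (n + 1))) (hσ : σ 0 = 0)
    {j : Fin (n + 1)} (hj : j ≠ 0) :
    IsShallow (σ * swap 0 j) ↔ IsShallow σ ∧ IsExtremal σ j := by
  obtain ⟨hle, hiff⟩ := excess_mul_swap_zero σ hσ hj
  have hpos := excess_nonneg σ
  rw [isShallow_iff_excess, isShallow_iff_excess, ← hiff]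
  omega

theorem IsShallow.inv {n : ℕ} {π : Perm (Fin n)} (h : IsShallow π) : IsShallow π⁻¹ := by
  rw [isShallow_iff_excess] at h ⊢
  rw [excess_inv, h]

theorem Avoids132.inv {n : ℕ} {π : Perm (Fin n)} (h : Avoids132 π) : Avoids132 π⁻¹ := by
  rintro ⟨i, j, k, hij, hjk, hik, hkj⟩
  exact h ⟨π⁻¹ i, π⁻¹ k, π⁻¹ j, hik, hkj, by simpa using hij, by simpa using hjk⟩

theorem apply_last_or_zero_extreme {n : ℕ} {π : Perm (Fin (n + 1))} (hs : IsShallow π)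
    (ha : Avoids132 π) :
    π (Fin.last n) = Fin.last n ∨ π 0 = Fin.last n ∨ π (Fin.last n) = 0 := by
  by_contra! hcon
  obtain ⟨hlast, hzero, hne⟩ := hcon
  obtain ⟨j, hj⟩ := π.surjective (Fin.last n)
  have hjlast : j ≠ Fin.last n := fun h => hlast (h ▸ hj)
  have hjzero : j ≠ 0 := fun h => hzero (h ▸ hj)
  have hjlt : j < Fin.last n := Fin.lt_last_iff_ne_last.2 hjlast
  have hmlt : π (Fin.last n) < π j := by
    rw [hj]
    exact Fin.lt_last_iff_ne_last.2 hlast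
  have hleft : ∀ k < j, π (Fin.last n) < π k := fun k hk => by
    by_contra hle
    have hne : π k ≠ π (Fin.last n) := fun h => (hk.trans hjlt).ne (π.injective h)
    exact ha ⟨k, j, _, hk, hjlt, lt_of_le_of_ne (not_lt.1 hle) hne, hmlt⟩
  have hsh := (isShallow_mul_swap_last (π * swap j (Fin.last n)) (by simp [hj]) hjlast).1
    (by rwa [mul_assoc, swap_mul_self, mul_one])
  have hval : ∀ k, k ≠ j → k ≠ Fin.last n → (π * swap j (Fin.last n)) k = π k := fun k h1 h2 => by
    rw [Perm.mul_apply, swap_apply_of_ne_of_ne h1 h2]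
  have hvalj : (π * swap j (Fin.last n)) j = π (Fin.last n) := by simp
  rcases hsh.2 with h | h
  · have h0 := h 0 (Fin.pos_iff_ne_zero.2 hjzero)
    rw [hvalj, hval 0 hjzero.symm (fun h => (Fin.zero_le j).not_gt (h ▸ hjlt))] at h0
    exact h0.asymm (hleft 0 (Fin.pos_iff_ne_zero.2 hjzero))
  · obtain ⟨k, hk⟩ := π.surjective 0
    have hklast : k ≠ Fin.last n := fun h => hne (h ▸ hk)
    rcases lt_trichotomy k j with hlt | rfl | hgt
    · exact absurd (hleft k hlt) (by simp [hk])
    · exact absurd hmlt (by simp [hk])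
    · have := h k hgt
      rw [hvalj, hval k hgt.ne' hklast, hk] at this
      exact absurd this (by simp)

theorem apply_zero_of_apply_last_eq_zero {n : ℕ} {π : Perm (Fin (n + 2))} (hs : IsShallow π)
    (ha : Avoids132 π) (hπ : π (Fin.last (n + 1)) = 0) :
    π 0 = Fin.last (n + 1) ∨ π (Fin.last n).castSucc = Fin.last (n + 1) ∨
      π 0 = (Fin.last n).castSucc := by
  by_contra! hcon
  obtain ⟨hzero, hpen, hsec⟩ := hcon
  obtain ⟨j, hj⟩ := π.surjective (Fin.last (n + 1))
  have hjlast : j ≠ Fin.last (n + 1) := by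
    rintro rfl
    rw [hπ] at hj
    exact Fin.last_pos.ne hj
  have hjzero : j ≠ 0 := fun h => hzero (h ▸ hj)
  have hjpen : j ≠ (Fin.last n).castSucc := fun h => hpen (h ▸ hj)
  have hjlt : j < (Fin.last n).castSucc := by
    simp only [ne_eq, Fin.ext_iff, Fin.lt_def, Fin.val_castSucc, Fin.val_last] at *
    omega
  have hjpos : 0 < j := Fin.pos_iff_ne_zero.2 hjzero
  have hright : ∀ k, j < k → π k < π 0 := fun k hk => by
    by_contra hle
    have hne : π 0 ≠ π k := fun h => (hjpos.trans hk).ne (π.injective h)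
    refine ha ⟨0, j, k, hjpos, hk, lt_of_le_of_ne (not_lt.1 hle) hne, ?_⟩
    rw [hj]
    exact Fin.lt_last_iff_ne_last.2 fun h => hk.ne' (π.injective (h.trans hj.symm))
  set σ := π * swap j (Fin.last (n + 1)) with hσ
  have hval : ∀ k, k ≠ j → k ≠ Fin.last (n + 1) → σ k = π k := fun k h1 h2 => by
    rw [hσ, Perm.mul_apply, swap_apply_of_ne_of_ne h1 h2]
  have hσj : σ j = 0 := by simp [hσ, hπ]
  have hσ0 : σ 0 = π 0 := hval 0 hjzero.symm Fin.last_pos.ne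
  have hσs : IsShallow σ :=
    ((isShallow_mul_swap_last σ (by simp [hσ, hj]) hjlast).1
      (by rwa [hσ, mul_assoc, swap_mul_self, mul_one])).1
  have hext := ((isShallow_mul_swap_zero (σ * swap 0 j) (by simp [hσj]) hjzero).1
    (by rwa [mul_assoc, swap_mul_self, mul_one])).2
  have hval' : ∀ k, k ≠ 0 → k ≠ j → k ≠ Fin.last (n + 1) → (σ * swap 0 j) k = π k :=
    fun k h0 h1 h2 => by rw [Perm.mul_apply, swap_apply_of_ne_of_ne h0 h1, hval k h1 h2]
  have hτj : (σ * swap 0 j) j = π 0 := by simp [hσ0]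
  rcases hext with h | h
  · obtain ⟨k, hk⟩ := π.surjective (Fin.last n).castSucc
    have hk0 : k ≠ 0 := fun h => hsec (h ▸ hk)
    have hlt : π k < π 0 := by
      rcases lt_trichotomy k j with hlt | rfl | hgt
      · have := h k hlt
        rwa [hτj, hval' k hk0 hlt.ne
          (hlt.trans (hjlt.trans (Fin.castSucc_lt_last _))).ne] at this
      · rw [hj] at hk
        exact absurd hk (Fin.castSucc_lt_last _).ne'
      · exact hright k hgt
    rw [hk] at hlt
    simp only [ne_eq, Fin.ext_iff, Fin.lt_def, Fin.val_castSucc, Fin.val_last] at hlt hzero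
    omega
  · have := h _ hjlt
    rw [hτj, hval' _ (hjpos.trans hjlt).ne' hjlt.ne' (Fin.castSucc_lt_last _).ne] at this
    exact this.asymm (hright _ hjlt)

theorem apply_last_of_apply_zero_eq_last {n : ℕ} {π : Perm (Fin (n + 2))} (hs : IsShallow π)
    (ha : Avoids132 π) (hπ : π 0 = Fin.last (n + 1)) :
    π (Fin.last (n + 1)) = 0 ∨ π (Fin.last n).castSucc = 0 ∨
      π (Fin.last (n + 1)) = (Fin.last n).castSucc := by
  have h := apply_zero_of_apply_last_eq_zero hs.inv ha.inv (Perm.inv_eq_iff_eq.2 hπ.symm)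
  simp only [Perm.inv_eq_iff_eq] at h
  rcases h with h | h | h
  · exact Or.inl h.symm
  · exact Or.inr (Or.inr h.symm)
  · exact Or.inr (Or.inl h.symm)

theorem Avoids132.of_insertEntry {n : ℕ} {i p : Fin (n + 1)} {e : Perm (Fin n)}
    (h : Avoids132 (insertEntry i p e)) : Avoids132 e := by
  rintro ⟨a, b, c, hab, hbc, hac, hcb⟩
  refine h ⟨i.succAbove a, i.succAbove b, i.succAbove c, ?_⟩
  simpa [Fin.succAbove_lt_succAbove_iff] using ⟨hab, hbc, hac, hcb⟩

/-- Inserting an entry that takes part in no `132` pattern preserves avoidance. -/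
theorem Avoids132.insertEntry {n : ℕ} {i p : Fin (n + 1)} {e : Perm (Fin n)} (h : Avoids132 e)
    (hi : ∀ a b c, a < b → b < c → insertEntry i p e a < insertEntry i p e c →
      insertEntry i p e c < insertEntry i p e b → a ≠ i ∧ b ≠ i ∧ c ≠ i) :
    Avoids132 (insertEntry i p e) := by
  rintro ⟨a, b, c, hab, hbc, hac, hcb⟩
  obtain ⟨ha, hb, hc⟩ := hi a b c hab hbc hac hcb
  obtain ⟨a, rfl⟩ := Fin.exists_succAbove_eq ha
  obtain ⟨b, rfl⟩ := Fin.exists_succAbove_eq hb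
  obtain ⟨c, rfl⟩ := Fin.exists_succAbove_eq hc
  simp only [insertEntry_succAbove, Fin.succAbove_lt_succAbove_iff] at hab hbc hac hcb
  exact h ⟨a, b, c, hab, hbc, hac, hcb⟩

theorem avoids132_insertEntry_last_last {n : ℕ} {e : Perm (Fin n)} :
    Avoids132 (insertEntry (Fin.last n) (Fin.last n) e) ↔ Avoids132 e := by
  refine ⟨.of_insertEntry, fun h => h.insertEntry fun a b c hab hbc _ hcb => ⟨?_, ?_, ?_⟩⟩
  · exact (hab.trans_le (Fin.le_last b)).ne
  · exact (hbc.trans_le (Fin.le_last c)).ne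
  · rintro rfl
    rw [insertEntry_self] at hcb
    exact (Fin.le_last _).not_gt hcb

theorem avoids132_insertEntry_last_zero {n : ℕ} {e : Perm (Fin n)} :
    Avoids132 (insertEntry (Fin.last n) 0 e) ↔ Avoids132 e := by
  refine ⟨.of_insertEntry, fun h => h.insertEntry fun a b c hab hbc hac _ => ⟨?_, ?_, ?_⟩⟩
  · exact (hab.trans_le (Fin.le_last b)).ne
  · exact (hbc.trans_le (Fin.le_last c)).ne
  · rintro rfl
    rw [insertEntry_self] at hac
    exact (Fin.zero_le _).not_gt hac

theorem avoids132_insertEntry_zero {n : ℕ} {p : Fin (n + 1)} (hp : n ≤ p + 1) {e : Perm (Fin n)} :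
    Avoids132 (insertEntry 0 p e) ↔ Avoids132 e := by
  refine ⟨.of_insertEntry, fun h => h.insertEntry fun a b c hab hbc hac hcb => ⟨?_, ?_, ?_⟩⟩
  · rintro rfl
    rw [insertEntry_self, Fin.lt_def] at hac
    rw [Fin.lt_def] at hcb
    omega
  · exact ((Fin.zero_le a).trans_lt hab).ne'
  · exact ((Fin.zero_le b).trans_lt hbc).ne'

theorem avoids132_insertEntry_last_penultimate {n : ℕ} {e : Perm (Fin (n + 1))}
    (he : e 0 = Fin.last n) :
    Avoids132 (insertEntry (Fin.last (n + 1)) (Fin.last n).castSucc e) ↔ Avoids132 e := by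
  refine ⟨.of_insertEntry, fun h => h.insertEntry fun a b c hab hbc hac hcb => ⟨?_, ?_, ?_⟩⟩
  · exact (hab.trans_le (Fin.le_last b)).ne
  · exact (hbc.trans_le (Fin.le_last c)).ne
  · rintro rfl
    obtain ⟨b, rfl⟩ := Fin.exists_succAbove_eq hbc.ne
    rw [insertEntry_self, insertEntry_succAbove, Fin.lt_succAbove_iff_le_castSucc,
      Fin.castSucc_le_castSucc_iff] at hcb
    have hb : e b = Fin.last n := Fin.last_le_iff.1 hcb
    rw [← he, e.injective.eq_iff] at hb
    subst hb
    simp at hab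

@[simp]
theorem insertEntry_last_castSucc {n : ℕ} (p : Fin (n + 1)) (e : Perm (Fin n)) (k : Fin n) :
    insertEntry (Fin.last n) p e k.castSucc = p.succAbove (e k) := by
  rw [← Fin.succAbove_last_apply, insertEntry_succAbove]

@[simp]
theorem insertEntry_zero_succ {n : ℕ} (p : Fin (n + 1)) (e : Perm (Fin n)) (k : Fin n) :
    insertEntry 0 p e k.succ = p.succAbove (e k) := by
  rw [← Fin.succAbove_zero_apply, insertEntry_succAbove]

@[simp]
theorem insertEntry_last_zero {n : ℕ} (p : Fin (n + 2)) (e : Perm (Fin (n + 1))) :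
    insertEntry (Fin.last (n + 1)) p e 0 = p.succAbove (e 0) :=
  insertEntry_last_castSucc p e 0

@[simp]
theorem insertEntry_last_insertEntry_zero_castSucc_succ {n : ℕ} (p : Fin (n + 2)) (q : Fin (n + 1))
    (e : Perm (Fin n)) (k : Fin n) :
    insertEntry (Fin.last (n + 1)) p (insertEntry 0 q e) k.castSucc.succ =
      p.succAbove (q.succAbove (e k)) := by
  rw [Fin.succ_castSucc, insertEntry_last_castSucc, insertEntry_zero_succ]

theorem isShallow_insertEntry_last_last {n : ℕ} {e : Perm (Fin n)} :
    IsShallow (insertEntry (Fin.last n) (Fin.last n) e) ↔ IsShallow e := by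
  rw [isShallow_iff_excess, isShallow_iff_excess, excess_insertEntry_last]

theorem isShallow_insertEntry_zero_zero {n : ℕ} {e : Perm (Fin n)} :
    IsShallow (insertEntry 0 0 e) ↔ IsShallow e := by
  rw [isShallow_iff_excess, isShallow_iff_excess, excess_insertEntry_zero]

theorem isExtremal_zero {n : ℕ} (σ : Perm (Fin (n + 1))) : IsExtremal σ 0 :=
  Or.inl fun k hk => absurd hk (Fin.zero_le k).not_gt

theorem succ_castSucc_last (n : ℕ) : (Fin.last n).castSucc.succ = (Fin.last (n + 1)).castSucc := rfl

theorem castSucc_last_succAbove_of_ne {n : ℕ} {x : Fin (n + 1)} (hx : x ≠ Fin.last n) :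
    (Fin.last n).castSucc.succAbove x = x.castSucc :=
  Fin.succAbove_of_castSucc_lt _ _ (Fin.castSucc_lt_castSucc_iff.2 (Fin.lt_last_iff_ne_last.2 hx))

theorem castSucc_last_succAbove_last (n : ℕ) :
    (Fin.last n).castSucc.succAbove (Fin.last n) = Fin.last (n + 1) := by
  rw [Fin.succAbove_castSucc_self, Fin.succ_last]

theorem isShallow_insertEntry_last_penultimate {n : ℕ} {e : Perm (Fin (n + 1))}
    (he : e 0 = Fin.last n) :
    IsShallow (insertEntry (Fin.last (n + 1)) (Fin.last n).castSucc e) ↔ IsShallow e := by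
  have heq : insertEntry (Fin.last (n + 1)) (Fin.last n).castSucc e =
      insertEntry (Fin.last (n + 1)) (Fin.last (n + 1)) e * swap 0 (Fin.last (n + 1)) := by
    ext k : 1
    rw [Perm.mul_apply]
    induction k using Fin.lastCases with
    | last => simp [he]
    | cast k =>
      by_cases hk : k = 0
      · simp [hk, he]
      · have hne : e k ≠ Fin.last n := fun h => hk (e.injective (h.trans he.symm))
        rw [swap_apply_of_ne_of_ne (by simpa using hk) (Fin.castSucc_lt_last k).ne,
          insertEntry_last_castSucc, insertEntry_last_castSucc, castSucc_last_succAbove_of_ne hne,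
          Fin.succAbove_last_apply]
  rw [heq, isShallow_mul_swap_last _ (insertEntry_self _ _ _) Fin.last_pos.ne,
    isShallow_insertEntry_last_last, and_iff_left (isExtremal_zero _)]

theorem isShallow_insertEntry_max_min {n : ℕ} {f : Perm (Fin n)} :
    IsShallow (insertEntry (Fin.last (n + 1)) 0 (insertEntry 0 (Fin.last n) f)) ↔ IsShallow f := by
  have heq : insertEntry (Fin.last (n + 1)) 0 (insertEntry 0 (Fin.last n) f) =
      insertEntry (Fin.last (n + 1)) (Fin.last (n + 1)) (insertEntry 0 0 f) *
        swap 0 (Fin.last (n + 1)) := by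
    ext k : 1
    rw [Perm.mul_apply]
    induction k using Fin.lastCases with
    | last => simp
    | cast k =>
      induction k using Fin.cases with
      | zero => simp
      | succ k =>
        rw [swap_apply_of_ne_of_ne (by simp) (Fin.castSucc_lt_last _).ne]
        simp
  rw [heq, isShallow_mul_swap_last _ (insertEntry_self _ _ _) Fin.last_pos.ne,
    isShallow_insertEntry_last_last, isShallow_insertEntry_zero_zero,
    and_iff_left (isExtremal_zero _)]

theorem isShallow_insertEntry_submax_min {n : ℕ} {f : Perm (Fin (n + 1))} :
    IsShallow (insertEntry (Fin.last (n + 2)) 0 (insertEntry 0 (Fin.last n).castSucc f)) ↔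
      IsShallow f := by
  obtain ⟨l, hl⟩ := f.surjective (Fin.last n)
  set σ := insertEntry (Fin.last (n + 2)) (Fin.last (n + 2)) (insertEntry 0 0 f) with hσ
  set j : Fin (n + 3) := l.succ.castSucc with hj
  have hj0 : j ≠ 0 := by simp [hj]
  have hjl : j ≠ Fin.last (n + 2) := (Fin.castSucc_lt_last _).ne
  have hσ0 : σ 0 = 0 := by simp [hσ]
  have hσl : σ (Fin.last (n + 2)) = Fin.last (n + 2) := insertEntry_self _ _ _
  have hσj : σ j = (Fin.last (n + 1)).castSucc := by
    simp [hσ, hj, hl]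
  have heq : insertEntry (Fin.last (n + 2)) 0 (insertEntry 0 (Fin.last n).castSucc f) =
      σ * swap 0 j * swap j (Fin.last (n + 2)) := by
    ext k : 1
    rw [Perm.mul_apply, Perm.mul_apply]
    induction k using Fin.lastCases with
    | last => simp [hσ0]
    | cast k =>
      induction k using Fin.cases with
      | zero =>
        rw [Fin.castSucc_zero, swap_apply_of_ne_of_ne hj0.symm Fin.last_pos.ne, swap_apply_left, hσj]
        simp [succ_castSucc_last]
      | succ k =>
        by_cases hk : k = l
        · rw [hk, ← hj, swap_apply_left, swap_apply_of_ne_of_ne Fin.last_pos.ne' hjl.symm, hσl, hj]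
          simp [hl]
        · have hne : f k ≠ Fin.last n := fun h => hk (f.injective (h.trans hl.symm))
          have hkj : k.succ.castSucc ≠ j := by simpa [hj] using hk
          rw [swap_apply_of_ne_of_ne hkj (Fin.castSucc_lt_last _).ne,
            swap_apply_of_ne_of_ne (by simp) hkj]
          simp [hσ, castSucc_last_succAbove_of_ne hne]
  have hmin : IsExtremal (σ * swap 0 j) j := Or.inr fun k hk => by
    rw [show (σ * swap 0 j) j = 0 by simp [hσ0], Fin.pos_iff_ne_zero]
    intro h
    exact hk.ne' ((σ * swap 0 j).injective (h.trans (by simp [hσ0])))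
  have hmax : IsExtremal σ j := Or.inl fun k hk => by
    have h1 : σ k ≠ σ j := fun h => hk.ne (σ.injective h)
    have h2 : σ k ≠ σ (Fin.last (n + 2)) := fun h =>
      (hk.trans_le (Fin.le_last j)).ne (σ.injective h)
    rw [hσj] at h1 ⊢
    rw [hσl] at h2
    simp only [ne_eq, Fin.ext_iff, Fin.lt_def, Fin.val_castSucc, Fin.val_last] at h1 h2 ⊢
    omega
  have hfix : (σ * swap 0 j) (Fin.last (n + 2)) = Fin.last (n + 2) := by
    rw [Perm.mul_apply, swap_apply_of_ne_of_ne Fin.last_pos.ne' hjl.symm, hσl]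
  rw [heq, isShallow_mul_swap_last _ hfix hjl, and_iff_left hmin,
    isShallow_mul_swap_zero _ hσ0 hj0, and_iff_left hmax, hσ,
    isShallow_insertEntry_last_last, isShallow_insertEntry_zero_zero]

open Classical in
/-- The number of shallow `132`-avoiding permutations of length `n` satisfying `P`. -/
noncomputable def countGood (n : ℕ) (P : Perm (Fin n) → Prop) : ℕ :=
  #{π : Perm (Fin n) | (IsShallow π ∧ Avoids132 π) ∧ P π}

theorem countGood_congr {n : ℕ} {P Q : Perm (Fin n) → Prop}
    (h : ∀ π, IsShallow π → Avoids132 π → (P π ↔ Q π)) : countGood n P = countGood n Q := by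
  classical
  rw [countGood, countGood]
  congr 1
  ext π
  simpa using fun h1 h2 => h π h1 h2

theorem countGood_eq_of_injective {m n : ℕ} {F : Perm (Fin m) → Perm (Fin n)}
    (hF : Function.Injective F) {P : Perm (Fin m) → Prop} {Q : Perm (Fin n) → Prop}
    (hsurj : ∀ π, Q π → ∃ e, F e = π) (hQ : ∀ e, Q (F e) ↔ P e)
    (hs : ∀ e, P e → (IsShallow (F e) ↔ IsShallow e))
    (ha : ∀ e, P e → (Avoids132 (F e) ↔ Avoids132 e)) :
    countGood n Q = countGood m P := by
  classical
  rw [countGood, countGood, ← Finset.card_image_of_injective _ hF]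
  congr 1
  ext π
  simp only [mem_filter, mem_univ, true_and, mem_image]
  constructor
  · rintro ⟨hπ, hq⟩
    obtain ⟨e, rfl⟩ := hsurj π hq
    have hP := (hQ e).1 hq
    exact ⟨e, ⟨⟨(hs e hP).1 hπ.1, (ha e hP).1 hπ.2⟩, hP⟩, rfl⟩
  · rintro ⟨e, ⟨he, hP⟩, rfl⟩
    exact ⟨⟨(hs e hP).2 he.1, (ha e hP).2 he.2⟩, (hQ e).2 hP⟩

theorem countGood_inv {n : ℕ} (P : Perm (Fin n) → Prop) :
    countGood n (fun π => P π⁻¹) = countGood n P :=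
  (countGood_eq_of_injective inv_injective (fun π _ => ⟨π⁻¹, inv_inv π⟩) (fun _ => Iff.rfl)
    (fun e _ => ⟨fun h => inv_inv e ▸ h.inv, fun h => h.inv⟩)
    (fun e _ => ⟨fun h => inv_inv e ▸ h.inv, fun h => h.inv⟩)).symm

theorem countGood_last_last (n : ℕ) :
    countGood (n + 1) (fun π => π (Fin.last n) = Fin.last n) = countGood n fun _ => True :=
  countGood_eq_of_injective (insertEntry_injective _ _) (fun _ h => exists_insertEntry h)
    (fun _ => by simp) (fun _ _ => isShallow_insertEntry_last_last)
    (fun _ _ => avoids132_insertEntry_last_last)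

theorem countGood_zero_last_and_last_zero (n : ℕ) :
    countGood (n + 2) (fun π => π 0 = Fin.last (n + 1) ∧ π (Fin.last (n + 1)) = 0) =
      countGood n fun _ => True := by
  refine countGood_eq_of_injective
    (F := fun f => insertEntry (Fin.last (n + 1)) 0 (insertEntry 0 (Fin.last n) f))
    ((insertEntry_injective _ _).comp (insertEntry_injective _ _)) ?_ (fun _ => by simp)
    (fun _ _ => isShallow_insertEntry_max_min) fun _ _ =>
      avoids132_insertEntry_last_zero.trans (avoids132_insertEntry_zero (by simp))
  rintro π ⟨h0, hl⟩
  obtain ⟨e, rfl⟩ := exists_insertEntry hl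
  rw [insertEntry_last_zero, Fin.succAbove_zero, ← Fin.succ_last, Fin.succ_inj] at h0
  obtain ⟨f, rfl⟩ := exists_insertEntry h0
  exact ⟨f, rfl⟩

theorem countGood_zero_submax_and_last_zero (n : ℕ) :
    countGood (n + 3)
      (fun π => π 0 = (Fin.last (n + 1)).castSucc ∧ π (Fin.last (n + 2)) = 0) =
      countGood (n + 1) fun _ => True := by
  refine countGood_eq_of_injective
    (F := fun f => insertEntry (Fin.last (n + 2)) 0 (insertEntry 0 (Fin.last n).castSucc f))
    ((insertEntry_injective _ _).comp (insertEntry_injective _ _)) ?_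
    (fun _ => by simp [succ_castSucc_last]) (fun _ _ => isShallow_insertEntry_submax_min) fun _ _ =>
      avoids132_insertEntry_last_zero.trans (avoids132_insertEntry_zero (by simp))
  rintro π ⟨h0, hl⟩
  obtain ⟨e, rfl⟩ := exists_insertEntry hl
  rw [insertEntry_last_zero, Fin.succAbove_zero, ← Fin.succ_last, ← Fin.succ_castSucc,
    Fin.succ_inj] at h0
  obtain ⟨f, rfl⟩ := exists_insertEntry h0
  exact ⟨f, rfl⟩

theorem countGood_zero_last_and_penultimate_zero (n : ℕ) :
    countGood (n + 3)
      (fun π => π 0 = Fin.last (n + 2) ∧ π (Fin.last (n + 1)).castSucc = 0) =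
      countGood (n + 1) fun _ => True := by
  rw [← countGood_zero_submax_and_last_zero, ← countGood_inv]
  refine countGood_congr fun π _ _ => ?_
  simp only [Perm.inv_eq_iff_eq]
  exact ⟨fun h => ⟨h.2.symm, h.1.symm⟩, fun h => ⟨h.2.symm, h.1.symm⟩⟩

theorem countGood_zero_last_and_last_submax (n : ℕ) (P : Perm (Fin (n + 1)) → Prop)
    (Q : Perm (Fin (n + 2)) → Prop)
    (hQ : ∀ e, Q (insertEntry (Fin.last (n + 1)) (Fin.last n).castSucc e) ↔ P e) :
    countGood (n + 2)
      (fun π => (π 0 = Fin.last (n + 1) ∧ π (Fin.last (n + 1)) = (Fin.last n).castSucc) ∧ Q π) =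
      countGood (n + 1) fun e => e 0 = Fin.last n ∧ P e := by
  refine countGood_eq_of_injective (insertEntry_injective _ _)
    (fun _ h => exists_insertEntry h.1.2) (fun e => ?_)
    (fun _ h => isShallow_insertEntry_last_penultimate h.1)
    (fun _ h => avoids132_insertEntry_last_penultimate h.1)
  rw [hQ, insertEntry_last_zero, insertEntry_self, ← castSucc_last_succAbove_last,
    Fin.succAbove_right_inj]
  simp

theorem countGood_eq_sum {n : ℕ} (P : Perm (Fin n) → Prop) [DecidablePred P]
    [DecidablePred fun π : Perm (Fin n) => IsShallow π ∧ Avoids132 π] :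
    countGood n P = ∑ π : Perm (Fin n) with IsShallow π ∧ Avoids132 π, if P π then 1 else 0 := by
  rw [← Finset.card_filter, Finset.filter_filter, countGood]
  congr

theorem countGood_all_add (n : ℕ) :
    (countGood (n + 2) fun _ => True) + (countGood n fun _ => True) =
      (countGood (n + 1) fun _ => True) + 2 * countGood (n + 2) fun π => π 0 = Fin.last (n + 1) := by
  classical
  have hinv : (countGood (n + 2) fun π => π (Fin.last (n + 1)) = 0) =
      countGood (n + 2) fun π => π 0 = Fin.last (n + 1) := by
    rw [← countGood_inv]
    exact countGood_congr fun π _ _ => by rw [Perm.inv_eq_iff_eq, eq_comm]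
  rw [two_mul]
  nth_rewrite 1 [← hinv]
  rw [← countGood_last_last (n + 1), ← countGood_zero_last_and_last_zero n]
  simp only [countGood_eq_sum, ← Finset.sum_add_distrib]
  refine Finset.sum_congr rfl fun π hπ => ?_
  obtain ⟨hs, ha⟩ := (Finset.mem_filter.1 hπ).2
  have hor := apply_last_or_zero_extreme hs ha
  have h0l : (0 : Fin (n + 2)) ≠ Fin.last (n + 1) := Fin.last_pos.ne
  have hinj : π (Fin.last (n + 1)) = Fin.last (n + 1) → π 0 ≠ Fin.last (n + 1) := fun h h' =>
    h0l (π.injective (h'.trans h.symm))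
  split_ifs <;> grind

theorem countGood_zero_last_add (n : ℕ) :
    (countGood (n + 3) fun π => π 0 = Fin.last (n + 2)) + (countGood n fun _ => True) =
      2 * (countGood (n + 1) fun _ => True) +
        countGood (n + 2) fun π => π 0 = Fin.last (n + 1) := by
  classical
  have hY := countGood_zero_last_and_last_submax (n + 1) (fun _ => True) (fun _ => True)
    fun _ => Iff.rfl
  have hW := countGood_zero_last_and_last_submax (n + 1) (fun e => e (Fin.last (n + 1)) = 0)
    (fun π => π (Fin.last (n + 1)).castSucc = 0) fun e => by
      rw [insertEntry_last_castSucc, Fin.succAbove_eq_zero_iff (by simp)]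
  simp only [and_true] at hY
  rw [two_mul]
  nth_rewrite 1 [← countGood_zero_last_and_penultimate_zero n]
  rw [← countGood_zero_last_and_last_zero n, ← hW, ← hY, ← countGood_zero_last_and_last_zero (n + 1)]
  simp only [countGood_eq_sum, ← Finset.sum_add_distrib]
  refine Finset.sum_congr rfl fun π hπ => ?_
  obtain ⟨hs, ha⟩ := (Finset.mem_filter.1 hπ).2
  have hor := fun h => apply_last_of_apply_zero_eq_last hs ha h
  have hne : (0 : Fin (n + 3)) ≠ (Fin.last (n + 1)).castSucc := by simp [Fin.ext_iff]
  have hne' : (Fin.last (n + 2)) ≠ (Fin.last (n + 1)).castSucc := (Fin.castSucc_lt_last _).ne'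
  have hinj : π (Fin.last (n + 2)) = 0 → π (Fin.last (n + 1)).castSucc ≠ 0 := fun h h' =>
    hne' (π.injective (h.trans h'.symm))
  split_ifs <;> grind

theorem countGood_zero : (countGood 0 fun _ => True) = 1 := by
  classical
  rw [countGood, Finset.card_eq_one]
  refine ⟨1, ?_⟩
  ext π
  rw [Subsingleton.elim π 1]
  simp [IsShallow, invNum, reflLen, dispD, Avoids132]

theorem countGood_one : (countGood 1 fun _ => True) = 1 := by
  refine Eq.trans (countGood_congr fun π _ _ => ?_) ((countGood_last_last 0).trans countGood_zero)
  exact (iff_true_left trivial).2 (Subsingleton.elim (α := Fin 1) _ _)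

theorem countGood_two_zero_last : (countGood 2 fun π => π 0 = Fin.last 1) = 1 := by
  refine Eq.trans (countGood_congr fun π _ _ => ⟨fun h => ⟨h, ?_⟩, fun h => h.1⟩)
    ((countGood_zero_last_and_last_zero 0).trans countGood_zero)
  have hne : π (Fin.last 1) ≠ π 0 := fun h' => by simpa using π.injective h'
  rw [h] at hne
  have key : ∀ v : Fin 2, v ≠ Fin.last 1 → v = 0 := by decide
  exact key _ hne

theorem countGood_eq_fib (n : ℕ) :
    (countGood (n + 1) fun _ => True) = Nat.fib (2 * n + 1) ∧
      (countGood (n + 2) fun _ => True) = Nat.fib (2 * n + 3) ∧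
      (countGood (n + 2) fun π => π 0 = Fin.last (n + 1)) = countGood (n + 1) fun _ => True := by
  induction n with
  | zero =>
    have h : (countGood 2 fun _ => True) + (countGood 0 fun _ => True) =
        (countGood 1 fun _ => True) + 2 * countGood 2 fun π => π 0 = Fin.last 1 :=
      countGood_all_add 0
    rw [countGood_zero, countGood_one, countGood_two_zero_last] at h
    refine ⟨countGood_one, ?_, countGood_two_zero_last.trans countGood_one.symm⟩
    change (countGood 2 fun _ => True) = 2
    omega
  | succ n ih =>
    obtain ⟨h1, h2, h3⟩ := ih
    have hb := countGood_zero_last_add n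
    have ha := countGood_all_add n
    have ha' : (countGood (n + 3) fun _ => True) + (countGood (n + 1) fun _ => True) =
        (countGood (n + 2) fun _ => True) +
          2 * countGood (n + 3) fun π => π 0 = Fin.last (n + 2) := countGood_all_add (n + 1)
    have hb' : (countGood (n + 3) fun π => π 0 = Fin.last (n + 2)) =
        countGood (n + 2) fun _ => True := by omega
    refine ⟨h2, ?_, hb'⟩
    have f1 : Nat.fib (2 * n + 3) = Nat.fib (2 * n + 1) + Nat.fib (2 * n + 2) := Nat.fib_add_two
    have f2 : Nat.fib (2 * n + 4) = Nat.fib (2 * n + 2) + Nat.fib (2 * n + 3) := Nat.fib_add_two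
    have f3 : Nat.fib (2 * n + 5) = Nat.fib (2 * n + 3) + Nat.fib (2 * n + 4) := Nat.fib_add_two
    change (countGood (n + 3) fun _ => True) = Nat.fib (2 * n + 5)
    omega

theorem stmt15 (n : ℕ) (hn : 1 ≤ n) :
    Nat.card {π : Equiv.Perm (Fin n) // IsShallow π ∧ Avoids132 π} =
      Nat.fib (2 * n - 1) := by
  classical
  obtain ⟨m, rfl⟩ := Nat.exists_eq_add_of_le' hn
  rw [show 2 * (m + 1) - 1 = 2 * m + 1 by omega, ← (countGood_eq_fib m).1, countGood,
    Nat.card_eq_fintype_card, Fintype.card_subtype]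
  congr 1
  ext π
  simp
end

section
/- For n ≥ 1, the number of shallow 132-avoiding involutions of length n equals F_{n+1}, the (n+1)-st Fibonacci number (with F_1 = F_2 = 1). -/
open Equiv Finset

/-- No two arcs of `π` cross: there are no `a < c < π a < π c`. -/
def Noncrossing {n : ℕ} (π : Equiv.Perm (Fin n)) : Prop :=
  ∀ a c : Fin n, a < c → c < π a → ¬ π a < π c

section Involution

variable {n : ℕ} {π : Equiv.Perm (Fin n)}

theorem dispD_eq_of_involution (h : ∀ i, π (π i) = i) :
    dispD π = 2 * #{i | i < π i} + 2 * #{p : Fin n × Fin n | p.1 < p.2 ∧ p.2 < π p.1} := by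
  have hsplit : dispD π = ∑ i, ((π i : ℕ) - i) + ∑ i : Fin n, ((i : ℕ) - π i) := by
    rw [dispD, ← sum_add_distrib]
    exact sum_congr rfl fun i _ => by omega
  have hsymm : ∑ i : Fin n, ((i : ℕ) - π i) = ∑ i, ((π i : ℕ) - i) := by
    rw [← Equiv.sum_comp π]
    simp [h]
  have hpairs : #{p : Fin n × Fin n | p.1 < p.2 ∧ p.2 < π p.1} = ∑ i, #(Ioo i (π i)) := by
    rw [← card_sigma]
    refine card_bij' (fun p _ => ⟨p.1, p.2⟩) (fun p _ => (p.1, p.2)) ?_ ?_ ?_ ?_ <;> simp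
  rw [hsplit, hsymm, hpairs, card_filter, ← two_mul, ← mul_add, ← sum_add_distrib]
  congr 1
  refine sum_congr rfl fun i _ => ?_
  rw [Fin.card_Ioo]
  split_ifs with hi <;> rw [Fin.lt_def] at hi <;> omega

theorem invNum_eq_of_involution (h : ∀ i, π (π i) = i) :
    invNum π = #{i | i < π i} +
      2 * #{p : Fin n × Fin n | p.1 < p.2 ∧ p.2 < π p.1 ∧ π p.2 < π p.1} := by
  have hsplit : ({p : Fin n × Fin n | p.1 < p.2 ∧ π p.2 < π p.1} : Finset _) =
      ({p : Fin n × Fin n | p.1 < p.2 ∧ p.2 = π p.1} : Finset _) ∪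
        (({p : Fin n × Fin n | p.1 < p.2 ∧ p.2 < π p.1 ∧ π p.2 < π p.1} : Finset _) ∪
        ({p : Fin n × Fin n | p.1 < p.2 ∧ π p.1 < p.2 ∧ π p.2 < π p.1} : Finset _)) := by
    ext ⟨x, y⟩
    simp only [mem_filter, mem_univ, true_and, mem_union]
    have hx := h x
    grind
  have harcs : #{p : Fin n × Fin n | p.1 < p.2 ∧ p.2 = π p.1} = #{i | i < π i} := by
    refine card_bij' (fun p _ => p.1) (fun i _ => (i, π i)) ?_ ?_ ?_ ?_ <;> grind
  have hsymm : #{p : Fin n × Fin n | p.1 < p.2 ∧ π p.1 < p.2 ∧ π p.2 < π p.1} =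
      #{p : Fin n × Fin n | p.1 < p.2 ∧ p.2 < π p.1 ∧ π p.2 < π p.1} := by
    refine card_bij' (fun p _ => (π p.2, π p.1)) (fun p _ => (π p.2, π p.1)) ?_ ?_ ?_ ?_ <;> grind
  rw [invNum, hsplit, card_union_of_disjoint, card_union_of_disjoint, harcs, hsymm, two_mul]
  · rw [disjoint_left]; grind
  · rw [disjoint_left]; grind

theorem reflLen_eq_of_involution (h : ∀ i, π (π i) = i) : reflLen π = #{i | i < π i} := by
  have htype : π.cycleType.sum = π.cycleType.card * 2 := by
    have htwo : ∀ m ∈ π.cycleType, m = 2 := fun m hm => by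
      have hdvd : m ∣ 2 := (Perm.dvd_of_mem_cycleType hm).trans
        (orderOf_dvd_of_pow_eq_one (by ext i; simp [pow_two, h]))
      exact le_antisymm (Nat.le_of_dvd two_pos hdvd) (Perm.two_le_of_mem_cycleType hm)
    rw [Multiset.eq_replicate_card.2 htwo]
    simp
  have hsupp : π.support.card = 2 * #{i | i < π i} := by
    have hsplit : π.support = ({i | i < π i} : Finset _) ∪ ({i | π i < i} : Finset _) := by
      ext i
      simp only [Perm.mem_support, mem_union, mem_filter, mem_univ, true_and]
      grind
    have hsymm : #{i | π i < i} = #{i | i < π i} := by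
      refine card_bij' (fun i _ => π i) (fun i _ => π i) ?_ ?_ ?_ ?_ <;> grind
    rw [hsplit, card_union_of_disjoint, hsymm, two_mul]
    rw [disjoint_left]; grind
  have hfix : #{i | π i = i} + π.support.card = n := by
    have := card_filter_add_card_filter_not (s := (univ : Finset (Fin n))) (fun i => π i = i)
    simpa [Perm.support] using this
  rw [Perm.sum_cycleType] at htype
  rw [reflLen, cycNum]
  omega

theorem isShallow_iff_noncrossing (h : ∀ i, π (π i) = i) : IsShallow π ↔ Noncrossing π := by
  have hsplit : #{p : Fin n × Fin n | p.1 < p.2 ∧ p.2 < π p.1} =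
      #{p : Fin n × Fin n | p.1 < p.2 ∧ p.2 < π p.1 ∧ π p.1 < π p.2} +
      #{p : Fin n × Fin n | p.1 < p.2 ∧ p.2 < π p.1 ∧ π p.2 < π p.1} := by
    rw [← card_union_of_disjoint]
    · congr 1
      ext ⟨x, y⟩
      simp only [mem_filter, mem_univ, true_and, mem_union]
      have : π x = π y ↔ x = y := π.injective.eq_iff
      grind
    · rw [disjoint_left]; grind
  have hzero : #{p : Fin n × Fin n | p.1 < p.2 ∧ p.2 < π p.1 ∧ π p.1 < π p.2} = 0 ↔
      Noncrossing π := by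
    simp [card_eq_zero, filter_eq_empty_iff, Noncrossing]
  rw [← hzero, IsShallow, dispD_eq_of_involution h, invNum_eq_of_involution h,
    reflLen_eq_of_involution h, hsplit]
  omega

end Involution

/-- Noncrossing, 132-avoiding involutions of `ℕ` fixing everything from `n` on. -/
structure IsNoncrossingInvolution (n : ℕ) (f : ℕ → ℕ) : Prop where
  invol : ∀ i, f (f i) = i
  fixed : ∀ i, n ≤ i → f i = i
  avoids : ∀ i j k, i < j → j < k → f i < f k → ¬ f k < f j
  noncrossing : ∀ a c, a < c → c < f a → ¬ f a < f c

namespace IsNoncrossingInvolution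

variable {n : ℕ} {f : ℕ → ℕ}

theorem lt (hf : IsNoncrossingInvolution n f) {i : ℕ} (hi : i < n) : f i < n := by
  by_contra! hle
  have h₁ := hf.fixed _ hle
  have h₂ := hf.invol i
  omega

theorem last_eq (hf : IsNoncrossingInvolution (n + 2) f) :
    f (n + 1) = n + 1 ∨ f (n + 1) = 0 := by
  by_contra! hne
  have hlt := hf.lt (i := n + 1) (by omega)
  have hlt₀ := hf.lt (i := 0) (by omega)
  have hinv := hf.invol (n + 1)
  have hinv₀ := hf.invol 0
  have havoid := hf.avoids 0 (f (n + 1)) (n + 1) (by omega) (by omega)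
  have hcross := hf.noncrossing 0 (f (n + 1)) (by omega)
  grind

theorem mono (hf : IsNoncrossingInvolution n f) : IsNoncrossingInvolution (n + 1) f :=
  ⟨hf.invol, fun i hi => hf.fixed i (by omega), hf.avoids, hf.noncrossing⟩

theorem of_last (hf : IsNoncrossingInvolution (n + 1) f) (h : f n = n) :
    IsNoncrossingInvolution n f :=
  ⟨hf.invol, fun i hi => by
    rcases hi.eq_or_lt with rfl | hi
    · exact h
    · exact hf.fixed i hi, hf.avoids, hf.noncrossing⟩

end IsNoncrossingInvolution

/-- Shift `f` up by one and enclose it in the arc joining `0` and `n + 1`. -/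
def wrapArc (n : ℕ) (f : ℕ → ℕ) (i : ℕ) : ℕ :=
  if i = 0 then n + 1 else if i = n + 1 then 0 else f (i - 1) + 1

/-- Remove the arc joining `0` and `n + 1`. -/
def unwrapArc (n : ℕ) (g : ℕ → ℕ) (i : ℕ) : ℕ :=
  if i = n then n else g (i + 1) - 1

theorem IsNoncrossingInvolution.wrapArc {n : ℕ} {f : ℕ → ℕ} (hf : IsNoncrossingInvolution n f) :
    IsNoncrossingInvolution (n + 2) (wrapArc n f) := by
  have hlt := @hf.lt
  have hfix := hf.fixed
  have hinv := hf.invol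
  refine ⟨fun i => ?_, fun i hi => ?_, fun i j k hij hjk => ?_, fun a c hac => ?_⟩
  · have h₁ := hinv (i - 1)
    have h₂ := hfix (i - 1)
    have h₃ := hfix n le_rfl
    have h₄ := hinv n
    simp only [_root_.wrapArc]
    grind
  · have h₂ := hfix (i - 1)
    simp only [_root_.wrapArc]
    grind
  · have h₁ := hf.avoids (i - 1) (j - 1) (k - 1)
    have h₂ := @hlt (j - 1)
    have h₃ := hfix (k - 1)
    have h₄ := hfix (j - 1)
    simp only [_root_.wrapArc]
    grind
  · have h₁ := hf.noncrossing (a - 1) (c - 1)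
    have h₂ := @hlt (a - 1)
    have h₃ := @hlt (c - 1)
    have h₄ := hfix (a - 1)
    simp only [_root_.wrapArc]
    grind

theorem IsNoncrossingInvolution.unwrapArc {n : ℕ} {g : ℕ → ℕ}
    (hg : IsNoncrossingInvolution (n + 2) g) (h : g (n + 1) = 0) :
    IsNoncrossingInvolution n (unwrapArc n g) := by
  have hpos : ∀ i, i ≠ n → g (i + 1) ≠ 0 := fun i hi h0 => by
    have h₁ := hg.invol (i + 1)
    have h₂ := hg.invol (n + 1)
    grind
  have hne : ∀ i, g (i + 1) ≠ n + 1 := fun i hi => by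
    have h₁ := hg.invol (i + 1)
    grind
  have hfix := hg.fixed
  have hlt := @hg.lt
  refine ⟨fun i => ?_, fun i hi => ?_, fun i j k hij hjk => ?_, fun a c hac => ?_⟩
  · have h₁ := hg.invol (i + 1)
    have h₂ := hpos i
    have h₃ := hne i
    simp only [_root_.unwrapArc]
    grind
  · have h₁ := hfix (i + 1)
    simp only [_root_.unwrapArc]
    grind
  · have h₁ := hg.avoids (i + 1) (j + 1) (k + 1)
    have h₂ := @hlt (j + 1)
    have h₃ := hfix (k + 1)
    simp only [_root_.unwrapArc]
    grind
  · have h₁ := hg.noncrossing (a + 1) (c + 1)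
    have h₂ := @hlt (a + 1)
    have h₃ := hfix (c + 1)
    have h₄ := hfix (a + 1)
    simp only [_root_.unwrapArc]
    grind

theorem unwrapArc_wrapArc {n : ℕ} {f : ℕ → ℕ} (hf : IsNoncrossingInvolution n f) :
    unwrapArc n (wrapArc n f) = f := by
  funext i
  have := hf.fixed n le_rfl
  grind [unwrapArc, wrapArc]

theorem wrapArc_unwrapArc {n : ℕ} {g : ℕ → ℕ} (hg : IsNoncrossingInvolution (n + 2) g)
    (h : g (n + 1) = 0) : wrapArc n (unwrapArc n g) = g := by
  funext i
  have h₁ := hg.invol (n + 1)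
  have h₂ := hg.invol i
  grind [unwrapArc, wrapArc]

/-- Split by whether the last point is fixed or joined to the first one. -/
def noncrossingInvolutionEquivSum (n : ℕ) :
    {f // IsNoncrossingInvolution (n + 2) f} ≃
      {f // IsNoncrossingInvolution (n + 1) f} ⊕ {f // IsNoncrossingInvolution n f} where
  toFun f := if h : f.1 (n + 1) = n + 1 then .inl ⟨f.1, f.2.of_last h⟩
    else .inr ⟨unwrapArc n f.1, f.2.unwrapArc (f.2.last_eq.resolve_left h)⟩
  invFun := Sum.elim (fun f => ⟨f.1, f.2.mono⟩) (fun f => ⟨wrapArc n f.1, f.2.wrapArc⟩)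
  left_inv f := by
    by_cases h : f.1 (n + 1) = n + 1
    · simp [h]
    · simp [h, wrapArc_unwrapArc f.2 (f.2.last_eq.resolve_left h)]
  right_inv f := by
    rcases f with f | f
    · simp [f.2.fixed (n + 1) le_rfl]
    · have : wrapArc n f.1 (n + 1) ≠ n + 1 := by simp [wrapArc]
      simp [this, unwrapArc_wrapArc f.2]

/-- Extend a permutation of `Fin n` to `ℕ` by the identity. -/
def extendById {n : ℕ} (π : Equiv.Perm (Fin n)) (i : ℕ) : ℕ :=
  if h : i < n then π ⟨i, h⟩ else i

theorem isNoncrossingInvolution_extendById {n : ℕ} {π : Equiv.Perm (Fin n)}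
    (hπ : IsShallow π ∧ Avoids132 π ∧ π⁻¹ = π) :
    IsNoncrossingInvolution n (extendById π) := by
  obtain ⟨hs, ha, hinv⟩ := hπ
  have hinv' : ∀ i, π (π i) = i := fun i => by
    nth_rw 1 [← hinv]
    simp
  rw [isShallow_iff_noncrossing hinv'] at hs
  refine ⟨fun i => ?_, fun i hi => ?_, fun i j k hij hjk => ?_, fun a c hac => ?_⟩
  · by_cases hi : i < n <;> simp [extendById, hi, hinv']
  · simp [extendById, hi.not_gt]
  · intro h₁ h₂
    simp only [extendById] at h₁ h₂
    have hk : k < n := by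
      split_ifs at h₁ h₂ <;> omega
    have hj : j < n := hjk.trans hk
    have hi : i < n := hij.trans hj
    simp only [hi, hj, hk, dite_true] at h₁ h₂
    exact ha ⟨⟨i, hi⟩, ⟨j, hj⟩, ⟨k, hk⟩, hij, hjk, h₁, h₂⟩
  · intro h₁ h₂
    simp only [extendById] at h₁ h₂
    have ha : a < n := by
      by_contra ha
      simp only [ha, dite_false] at h₁
      omega
    simp only [ha, dite_true] at h₁ h₂
    have hc : c < n := h₁.trans (π ⟨a, ha⟩).2
    simp only [hc, dite_true] at h₂
    exact hs ⟨a, ha⟩ ⟨c, hc⟩ hac h₁ h₂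

/-- Restrict an involution of `ℕ` fixing everything from `n` on to `Fin n`. -/
def IsNoncrossingInvolution.toPerm {n : ℕ} {f : ℕ → ℕ} (hf : IsNoncrossingInvolution n f) :
    Equiv.Perm (Fin n) :=
  Function.Involutive.toPerm (fun i => ⟨f i, hf.lt i.2⟩) fun i => Fin.ext (hf.invol i)

theorem IsNoncrossingInvolution.toPerm_spec {n : ℕ} {f : ℕ → ℕ}
    (hf : IsNoncrossingInvolution n f) :
    IsShallow hf.toPerm ∧ Avoids132 hf.toPerm ∧ hf.toPerm⁻¹ = hf.toPerm := by
  refine ⟨(isShallow_iff_noncrossing fun i => Fin.ext (hf.invol i)).2 fun a c => ?_, ?_, rfl⟩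
  · exact hf.noncrossing a c
  · rintro ⟨i, j, k, hij, hjk, h₁, h₂⟩
    exact hf.avoids i j k hij hjk h₁ h₂

/-- Shallow 132-avoiding involutions are the noncrossing 132-avoiding ones. -/
def shallowInvolutionEquiv (n : ℕ) :
    {π : Equiv.Perm (Fin n) // IsShallow π ∧ Avoids132 π ∧ π⁻¹ = π} ≃
      {f // IsNoncrossingInvolution n f} where
  toFun π := ⟨extendById π.1, isNoncrossingInvolution_extendById π.2⟩
  invFun f := ⟨f.2.toPerm, f.2.toPerm_spec⟩
  left_inv π := by
    ext i
    simp [IsNoncrossingInvolution.toPerm, extendById]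
  right_inv f := by
    ext i
    by_cases hi : i < n
    · simp only [extendById, hi, dite_true]
      rfl
    · simp [extendById, hi, f.2.fixed i (not_lt.1 hi)]

instance finite_noncrossingInvolution (n : ℕ) : Finite {f // IsNoncrossingInvolution n f} :=
  Finite.of_equiv _ (shallowInvolutionEquiv n)

theorem card_noncrossingInvolution_of_le_one {n : ℕ} (hn : n ≤ 1) :
    Nat.card {f // IsNoncrossingInvolution n f} = 1 := by
  have hid : ∀ f, IsNoncrossingInvolution n f → f = id := fun f hf => by
    funext i
    by_cases hi : i < n
    · have := hf.lt hi
      simp only [id]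
      omega
    · exact hf.fixed i (not_lt.1 hi)
  rw [Nat.card_eq_one_iff_exists]
  refine ⟨⟨id, ⟨by simp, by simp, ?_, ?_⟩⟩, fun f => Subtype.ext (hid f.1 f.2)⟩
  · intro i j k; simp only [id]; omega
  · intro i j; simp only [id]; omega

theorem card_noncrossingInvolution (n : ℕ) :
    Nat.card {f // IsNoncrossingInvolution n f} = Nat.fib (n + 1) := by
  induction n using Nat.twoStepInduction with
  | zero => simpa using card_noncrossingInvolution_of_le_one zero_le_one
  | one => simpa using card_noncrossingInvolution_of_le_one le_rfl
  | more n ih₀ ih₁ =>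
    rw [Nat.card_congr (noncrossingInvolutionEquivSum n), Nat.card_sum, ih₀, ih₁,
      Nat.fib_add_two (n := n + 1), add_comm]

theorem stmt16 (n : ℕ) (hn : 1 ≤ n) :
    Nat.card {π : Equiv.Perm (Fin n) // IsShallow π ∧ Avoids132 π ∧ π⁻¹ = π} =
      Nat.fib (n + 1) := by
  rw [Nat.card_congr (shallowInvolutionEquiv n), card_noncrossingInvolution]
end
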